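/- arXiv:1606.06231 — 2 statements merged into one kernel-verified Lean document; each statement's English description precedes it below -/
import Mathlib

section
/- If u ∈ D'(ℝ^N) and ∇u ∈ (L^p_s)^N with s ∈ ℝ and 1 ≤ p < ∞, then the radial symmetrization u_S of u satisfies ∇u_S ∈ (L^p_s)^N and ||\,|∇u_S|\,||_{L^p_s} ≤ ||\,|∇u|\,||_{L^p_s}. -/
open MeasureTheory Metric Filter Topology ENNReal

noncomputable section

/-- Euclidean space `ℝ^N`. -/
abbrev Euc (N : ℕ) := EuclideanSpace ℝ (Fin N)

/-- Iterated classical partial derivative along a list of coordinate directions. -/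
def pderivList {N : ℕ} : List (Fin N) → (Euc N → ℝ) → Euc N → ℝ
  | [], φ => φ
  | i :: l, φ => pderivList l fun x => fderiv ℝ φ x (EuclideanSpace.single i 1)

/-- `g` is the weak (distributional) partial derivative of `u` of order given by the
list `l` of coordinate directions, i.e. `g = ∂_{l₁} ⋯ ∂_{l_r} u` in `D'(ℝ^N)`. -/
def IsWeakDerivList {N : ℕ} (l : List (Fin N)) (u g : Euc N → ℝ) : Prop :=
  LocallyIntegrable u volume ∧ LocallyIntegrable g volume ∧
    ∀ φ : Euc N → ℝ, ContDiff ℝ (⊤ : ℕ∞) φ → HasCompactSupport φ →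
      ∫ x, u x * pderivList l φ x = (-1 : ℝ) ^ l.length * ∫ x, g x * φ x

/-- `g` is the weak partial derivative `∂ᵢ u`. -/
def IsWeakPartialDeriv {N : ℕ} (i : Fin N) (u g : Euc N → ℝ) : Prop :=
  IsWeakDerivList [i] u g

/-- The weight `(1+|x|)^{-s-N/q}` of the space `L^q_s` (with `N/∞ := 0`). -/
def wt (N : ℕ) (s : ℝ) (q : ℝ≥0∞) (x : Euc N) : ℝ :=
  (1 + ‖x‖) ^ (-s - (N : ℝ) / q.toReal)

/-- Membership in the weighted space `L^q_s`. -/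
def MemLs (N : ℕ) (s : ℝ) (q : ℝ≥0∞) (u : Euc N → ℝ) : Prop :=
  MemLp (fun x => wt N s q x * u x) q volume

/-- The norm of the weighted space `L^q_s`. -/
def LsNorm (N : ℕ) (s : ℝ) (q : ℝ≥0∞) (u : Euc N → ℝ) : ℝ :=
  (eLpNorm (fun x => wt N s q x * u x) q volume).toReal

/-- Membership in the exponentially weighted space `L^q_{exp,s}`. -/
def MemLexp (N : ℕ) (s : ℝ) (q : ℝ≥0∞) (u : Euc N → ℝ) : Prop :=
  MemLp (fun x => Real.exp (-(s * ‖x‖)) * u x) q volume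

/-- The norm of the exponentially weighted space `L^q_{exp,s}`. -/
def LexpNorm (N : ℕ) (s : ℝ) (q : ℝ≥0∞) (u : Euc N → ℝ) : ℝ :=
  (eLpNorm (fun x => Real.exp (-(s * ‖x‖)) * u x) q volume).toReal

/-- The pointwise Euclidean (Frobenius) norm `|∇^k u|` of the `k`-th gradient, whose
components `g m` are indexed by the `k`-tuples `m` of coordinate directions. -/
def gradNormK {N k : ℕ} (g : (Fin k → Fin N) → Euc N → ℝ) (x : Euc N) : ℝ :=
  Real.sqrt (∑ m : Fin k → Fin N, g m x ^ 2)

/-- The pointwise Euclidean norm `|∇u|` of a first-order gradient. -/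
def gradNorm1 {N : ℕ} (g : Fin N → Euc N → ℝ) (x : Euc N) : ℝ :=
  Real.sqrt (∑ i, g i x ^ 2)

/-- The interval `I_{j,p}` of admissible exponents `q`. -/
def Ijp (N j : ℕ) (p : ℝ) : Set ℝ≥0∞ :=
  if p = (N : ℝ) / (j : ℝ) ∧ 1 < N then Set.Ico (ENNReal.ofReal p) ⊤
  else if p < (N : ℝ) / (j : ℝ) then
    Set.Icc (ENNReal.ofReal p) (ENNReal.ofReal ((N : ℝ) * p / ((N : ℝ) - (j : ℝ) * p)))
  else Set.Icc (ENNReal.ofReal p) ⊤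

/-- The average of `u` on the ball `B_ρ`. -/
def ballAvg {N : ℕ} (ρ : ℝ) (u : Euc N → ℝ) : ℝ :=
  (volume (ball (0 : Euc N) ρ)).toReal⁻¹ * ∫ y in ball (0 : Euc N) ρ, u y

/-- The radial symmetrization `u_S(x) = (Nω_N)⁻¹ ∫_{S^{N-1}} u(|x|σ) dσ`. -/
def radialSymmetrization {N : ℕ} (u : Euc N → ℝ) (x : Euc N) : ℝ :=
  ((N : ℝ) * (volume (ball (0 : Euc N) 1)).toReal)⁻¹ *
    ∫ σ : sphere (0 : Euc N) 1, u (‖x‖ • (σ : Euc N)) ∂((volume : Measure (Euc N)).toSphere)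

/-- `u` is radially symmetric: `u x` only depends on `|x|`. -/
def RadSymm {N : ℕ} (u : Euc N → ℝ) : Prop :=
  ∀ x y : Euc N, ‖x‖ = ‖y‖ → u x = u y

/-- Evaluation of a polynomial on `ℝ^N` at a point. -/
def polyEval {N : ℕ} (π : MvPolynomial (Fin N) ℝ) (x : Euc N) : ℝ :=
  MvPolynomial.eval (fun i => x i) π



/-- The polar parametrization `(σ, r) ↦ r σ`. -/
def polarMap (N : ℕ) (z : sphere (0 : Euc N) 1 × Set.Ioi (0 : ℝ)) : Euc N :=
  (z.2 : ℝ) • (z.1 : Euc N)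

/-- The surface measure on the sphere. -/
abbrev sphM (N : ℕ) : Measure (sphere (0 : Euc N) 1) := (volume : Measure (Euc N)).toSphere

/-- The radial measure. -/
abbrev radM (N : ℕ) : Measure (Set.Ioi (0 : ℝ)) := Measure.volumeIoiPow (N - 1)

theorem polarMap_eq (N : ℕ) :
    polarMap N = (Subtype.val : ({0}ᶜ : Set (Euc N)) → Euc N) ∘
      (homeomorphUnitSphereProd (Euc N)).symm := by
  funext z
  simp [polarMap]

theorem polarMap_emb (N : ℕ) : MeasurableEmbedding (polarMap N) := by
  rw [polarMap_eq]
  exact (MeasurableEmbedding.subtype_coe (measurableSet_singleton _).compl).comp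
      (Homeomorph.measurableEmbedding _)

theorem euc_nontrivial {N : ℕ} (hN : 1 ≤ N) : Nontrivial (Euc N) := by
  have : Nonempty (Fin N) := ⟨⟨0, hN⟩⟩
  infer_instance

theorem polarMap_mp {N : ℕ} (hN : 1 ≤ N) :
    MeasurePreserving (polarMap N) ((sphM N).prod (radM N)) volume := by
  have := euc_nontrivial hN
  have h1 := (volume : Measure (Euc N)).measurePreserving_homeomorphUnitSphereProd
  have h2 : MeasurePreserving (homeomorphUnitSphereProd (Euc N)).symm
      ((sphM N).prod (radM N)) ((volume : Measure (Euc N)).comap (↑)) := by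
    have := MeasurePreserving.symm (homeomorphUnitSphereProd (Euc N)).toMeasurableEquiv h1
    simpa using this
  have h3 : MeasurePreserving (Subtype.val : ({0}ᶜ : Set (Euc N)) → Euc N)
      ((volume : Measure (Euc N)).comap (↑)) volume := by
    refine ⟨measurable_subtype_coe, ?_⟩
    rw [map_comap_subtype_coe (measurableSet_singleton _).compl, restrict_compl_singleton]
  rw [polarMap_eq]
  exact h3.comp h2

theorem norm_polarMap {N : ℕ} (z : sphere (0 : Euc N) 1 × Set.Ioi (0 : ℝ)) :
    ‖polarMap N z‖ = z.2 := by
  have : (0:ℝ) < z.2 := z.2.2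
  simp [polarMap, norm_smul, abs_of_pos this]

theorem radS_eq {N : ℕ} (u : Euc N → ℝ) (x : Euc N) :
    radialSymmetrization u x = ⨍ σ, u (‖x‖ • (σ : Euc N)) ∂(sphM N) := by
  rw [average_eq, radialSymmetrization]
  simp [Measure.real]

theorem radS_polar {N : ℕ} (u : Euc N → ℝ) (z : sphere (0 : Euc N) 1 × Set.Ioi (0 : ℝ)) :
    radialSymmetrization u (polarMap N z) = ⨍ σ, u (polarMap N (σ, z.2)) ∂(sphM N) := by
  rw [radS_eq, norm_polarMap]; rfl

theorem radS_norm {N : ℕ} (u : Euc N → ℝ) {x y : Euc N} (h : ‖x‖ = ‖y‖) :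
    radialSymmetrization u x = radialSymmetrization u y := by
  simp only [radialSymmetrization, h]

theorem radS_aesm {N : ℕ} (hN : 1 ≤ N) {f : Euc N → ℝ} (hf : AEStronglyMeasurable f volume) :
    AEStronglyMeasurable (radialSymmetrization f) volume := by
  have h0 : AEStronglyMeasurable (f ∘ polarMap N) ((sphM N).prod (radM N)) :=
    hf.comp_measurePreserving (polarMap_mp hN)
  rw [← (polarMap_mp hN).aestronglyMeasurable_comp_iff (polarMap_emb N)]
  have h1 : AEStronglyMeasurable (fun r => ∫ σ, (f ∘ polarMap N) (σ, r) ∂(sphM N)) (radM N) :=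
    h0.prod_swap.integral_prod_right'
  have h2 := h1.comp_quasiMeasurePreserving (Measure.quasiMeasurePreserving_snd (μ := sphM N))
  refine (h2.const_mul ((sphM N).real Set.univ)⁻¹).congr (ae_of_all _ fun z => ?_)
  simp only [Function.comp, radS_polar, average_eq, smul_eq_mul]

theorem sphM_ne {N : ℕ} (hN : 1 ≤ N) : sphM N ≠ 0 := by
  have := euc_nontrivial hN
  exact Measure.toSphere_ne_zero _

theorem polar_lintegral {N : ℕ} (hN : 1 ≤ N) {f : Euc N → ℝ≥0∞} (hf : AEMeasurable f volume) :
    ∫⁻ x, f x = ∫⁻ r, ∫⁻ σ, f (polarMap N (σ, r)) ∂(sphM N) ∂(radM N) := by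
  rw [← (polarMap_mp hN).lintegral_comp_emb (polarMap_emb N)]
  exact lintegral_prod_symm _ (hf.comp_quasiMeasurePreserving (polarMap_mp hN).quasiMeasurePreserving)

theorem polar_integral {N : ℕ} (hN : 1 ≤ N) {f : Euc N → ℝ} (hf : Integrable f volume) :
    ∫ x, f x = ∫ r, ∫ σ, f (polarMap N (σ, r)) ∂(sphM N) ∂(radM N) := by
  rw [← (polarMap_mp hN).integral_comp (polarMap_emb N)]
  exact integral_prod_symm _ ((polarMap_mp hN).integrable_comp_of_integrable hf)

theorem radS_eLpNorm {N : ℕ} (hN : 1 ≤ N) {f : Euc N → ℝ} (hf : AEStronglyMeasurable f volume)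
    {p : ℝ} (hp : 1 ≤ p) :
    eLpNorm (radialSymmetrization f) (ENNReal.ofReal p) volume
      ≤ eLpNorm f (ENNReal.ofReal p) volume := by
  have hp0 : 0 < p := by linarith
  have hne : ENNReal.ofReal p ≠ 0 := by simpa using hp0
  have hS := radS_aesm hN hf
  have : NeZero (sphM N) := ⟨sphM_ne hN⟩
  rw [eLpNorm_eq_lintegral_rpow_enorm_toReal hne ENNReal.ofReal_ne_top,
    eLpNorm_eq_lintegral_rpow_enorm_toReal hne ENNReal.ofReal_ne_top,
    ENNReal.toReal_ofReal hp0.le]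
  gcongr ?_ ^ _
  rw [polar_lintegral hN (hS.enorm.pow_const p), polar_lintegral hN (hf.enorm.pow_const p)]
  have h0 : AEStronglyMeasurable (f ∘ polarMap N) ((sphM N).prod (radM N)) :=
    hf.comp_measurePreserving (polarMap_mp hN)
  have h1 := h0.prod_swap.prodMk_left
  refine lintegral_mono_ae ?_
  filter_upwards [h1] with r hr
  replace hr : AEStronglyMeasurable (fun σ => f (polarMap N (σ, r))) (sphM N) := hr
  simp only [radS_polar, lintegral_const]
  set π := ((sphM N) Set.univ)⁻¹ • sphM N with hπ
  have hprob : IsProbabilityMeasure π := inferInstance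
  have hr' : AEStronglyMeasurable (fun σ => f (polarMap N (σ, r))) π := hr.smul_measure _
  have key : ‖⨍ σ, f (polarMap N (σ, r)) ∂(sphM N)‖ₑ ^ p
      ≤ ∫⁻ σ, ‖f (polarMap N (σ, r))‖ₑ ^ p ∂π := by
    have e1 : ‖⨍ σ, f (polarMap N (σ, r)) ∂(sphM N)‖ₑ
        ≤ eLpNorm (fun σ => f (polarMap N (σ, r))) (ENNReal.ofReal p) π := by
      refine (enorm_integral_le_lintegral_enorm _).trans ?_
      rw [← eLpNorm_one_eq_lintegral_enorm]
      exact eLpNorm_le_eLpNorm_of_exponent_le (by simpa using hp) hr'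
    rw [eLpNorm_eq_lintegral_rpow_enorm_toReal hne ENNReal.ofReal_ne_top,
      ENNReal.toReal_ofReal hp0.le] at e1
    calc _ ≤ _ := ENNReal.rpow_le_rpow e1 hp0.le
      _ = _ := by rw [← ENNReal.rpow_mul, one_div_mul_cancel hp0.ne', ENNReal.rpow_one]
  calc _ ≤ _ := mul_le_mul_left key _
    _ = _ := by
      rw [hπ, lintegral_smul_measure, smul_eq_mul, mul_comm, ← mul_assoc,
        ENNReal.mul_inv_cancel (by rw [Ne, Measure.measure_univ_eq_zero]; exact sphM_ne hN) (measure_ne_top _ _), one_mul]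

theorem radS_integrable {N : ℕ} (hN : 1 ≤ N) {f : Euc N → ℝ} (hf : Integrable f volume) :
    Integrable (radialSymmetrization f) volume := by
  refine memLp_one_iff_integrable.1 ⟨radS_aesm hN hf.1, ?_⟩
  have := radS_eLpNorm hN hf.1 (le_refl (1:ℝ))
  rw [ENNReal.ofReal_one] at this
  exact this.trans_lt (memLp_one_iff_integrable.2 hf).2

/-- Radial factors can be pulled out. -/
theorem radS_mul_radial {N : ℕ} (h : ℝ → ℝ) (f : Euc N → ℝ) (x : Euc N) :
    radialSymmetrization (fun y => h ‖y‖ * f y) x = h ‖x‖ * radialSymmetrization f x := by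
  simp only [radialSymmetrization, norm_smul, norm_norm, norm_eq_of_mem_sphere, mul_one]
  rw [integral_const_mul]; ring

theorem radS_locInt {N : ℕ} (hN : 1 ≤ N) {f : Euc N → ℝ} (hf : LocallyIntegrable f volume) :
    LocallyIntegrable (radialSymmetrization f) volume := by
  rw [locallyIntegrable_iff]
  intro K hK
  obtain ⟨R, hR⟩ := hK.isBounded.subset_closedBall (0 : Euc N)
  refine IntegrableOn.mono_set ?_ hR
  rw [← integrable_indicator_iff isClosed_closedBall.measurableSet]
  have h1 : Integrable ((closedBall (0 : Euc N) R).indicator f) volume :=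
    (integrable_indicator_iff isClosed_closedBall.measurableSet).2
      (hf.integrableOn_isCompact (isCompact_closedBall _ _))
  have h2 := radS_integrable hN h1
  refine h2.congr (ae_of_all _ fun x => ?_)
  have e : ∀ f : Euc N → ℝ, (closedBall (0 : Euc N) R).indicator f =
      fun y => (Set.Iic R).indicator (fun _ => (1:ℝ)) ‖y‖ * f y := by
    intro f; funext y
    by_cases hy : ‖y‖ ≤ R <;> simp [hy, Set.indicator]
  rw [e, e, radS_mul_radial]

theorem radS_adj_int {N : ℕ} (hN : 1 ≤ N) {A B : Euc N → ℝ}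
    (h1 : Integrable (fun x => radialSymmetrization A x * B x) volume)
    (h2 : Integrable (fun x => A x * radialSymmetrization B x) volume) :
    ∫ x, radialSymmetrization A x * B x = ∫ x, A x * radialSymmetrization B x := by
  rw [polar_integral hN h1, polar_integral hN h2]
  refine integral_congr_ae (ae_of_all _ fun r => ?_)
  simp only [radS_polar, average_eq, integral_const_mul, integral_mul_const, smul_eq_mul]
  ring

theorem radS_bound {N : ℕ} (hN : 1 ≤ N) {B : Euc N → ℝ} {M : ℝ} (hB : ∀ x, |B x| ≤ M) (x : Euc N) :
    |radialSymmetrization B x| ≤ M := by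
  have : NeZero (sphM N) := ⟨sphM_ne hN⟩
  rw [radS_eq, average]
  have := norm_integral_le_of_norm_le_const (μ := ((sphM N) Set.univ)⁻¹ • sphM N)
    (f := fun σ => B (‖x‖ • (σ : Euc N))) (C := M) (ae_of_all _ fun σ => hB _)
  rwa [probReal_univ, mul_one] at this

theorem radS_supp {N : ℕ} {B : Euc N → ℝ} {R : ℝ} (hB : ∀ x, R ≤ ‖x‖ → B x = 0) (x : Euc N)
    (hx : R ≤ ‖x‖) : radialSymmetrization B x = 0 := by
  have : ∀ σ : sphere (0 : Euc N) 1, B (‖x‖ • (σ : Euc N)) = 0 := fun σ =>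
    hB _ (by simpa [norm_smul] using hx)
  simp [radialSymmetrization, this]

/-- Bounded, a.e. measurable, with bounded support. -/
structure BSupp {N : ℕ} (M R : ℝ) (B : Euc N → ℝ) : Prop where
  meas : AEStronglyMeasurable B volume
  bd : ∀ x, |B x| ≤ M
  supp : ∀ x, R ≤ ‖x‖ → B x = 0

theorem BSupp.radS {N : ℕ} (hN : 1 ≤ N) {M R : ℝ} {B : Euc N → ℝ} (h : BSupp M R B) :
    BSupp M R (radialSymmetrization B) :=
  ⟨radS_aesm hN h.meas, radS_bound hN h.bd, radS_supp h.supp⟩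

theorem BSupp.integrable_mul {N : ℕ} {M R : ℝ} {A B : Euc N → ℝ} (h : BSupp M R B)
    (hA : LocallyIntegrable A volume) : Integrable (fun x => A x * B x) volume := by
  have h1 : IntegrableOn A (closedBall (0 : Euc N) R) volume :=
    hA.integrableOn_isCompact (isCompact_closedBall _ _)
  have h2 : IntegrableOn (fun x => A x * B x) (closedBall (0 : Euc N) R) volume :=
    Integrable.mul_bdd (c := M) h1 h.meas.restrict (ae_of_all _ h.bd)
  refine (integrableOn_iff_integrable_of_support_subset ?_).1 h2
  intro x hx
  by_contra hc
  simp only [mem_closedBall, dist_zero_right, not_le] at hc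
  exact hx (by simp [h.supp x hc.le])

theorem radS_adj {N : ℕ} (hN : 1 ≤ N) {M R : ℝ} {A B : Euc N → ℝ}
    (hA : LocallyIntegrable A volume) (hB : BSupp M R B) :
    ∫ x, radialSymmetrization A x * B x = ∫ x, A x * radialSymmetrization B x :=
  radS_adj_int hN (hB.integrable_mul (radS_locInt hN hA)) ((hB.radS hN).integrable_mul hA)

theorem BSupp.locInt {N : ℕ} {M R : ℝ} {B : Euc N → ℝ} (h : BSupp M R B) :
    LocallyIntegrable B volume := by
  have := h.integrable_mul (A := fun _ => (1:ℝ)) (locallyIntegrable_const _)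
  simpa using this.locallyIntegrable

/-- Components of the unit radial field. -/
def er {N : ℕ} (i : Fin N) (x : Euc N) : ℝ := x i / ‖x‖

theorem er_meas {N : ℕ} (i : Fin N) : Measurable (er i : Euc N → ℝ) := by
  unfold er
  fun_prop

theorem sum_er_sq_le {N : ℕ} (x : Euc N) : ∑ i, er i x ^ 2 ≤ 1 := by
  simp only [er, div_pow, ← Finset.sum_div]
  rw [← EuclideanSpace.real_norm_sq_eq]
  exact div_self_le_one _

theorem er_le {N : ℕ} (i : Fin N) (x : Euc N) : |er i x| ≤ 1 := by
  rw [← sq_le_one_iff_abs_le_one]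
  exact (Finset.single_le_sum (f := fun i => er i x ^ 2) (fun _ _ => sq_nonneg _)
    (Finset.mem_univ i)).trans (sum_er_sq_le x)

theorem BSupp.er_mul {N : ℕ} {M R : ℝ} {B : Euc N → ℝ} (h : BSupp M R B) (i : Fin N) :
    BSupp M R (fun x => er i x * B x) := by
  refine ⟨(er_meas i).aestronglyMeasurable.mul h.meas, fun x => ?_, fun x hx => by simp [h.supp x hx]⟩
  rw [abs_mul]
  have := mul_le_mul (er_le i x) (h.bd x) (abs_nonneg _) zero_le_one
  simpa using this

theorem er_mul_locInt {N : ℕ} {A : Euc N → ℝ} (hA : LocallyIntegrable A volume) (i : Fin N) :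
    LocallyIntegrable (fun x => er i x * A x) volume := by
  refine hA.mono ((er_meas i).aestronglyMeasurable.mul hA.aestronglyMeasurable) (ae_of_all _ fun x => ?_)
  rw [norm_mul]
  exact mul_le_of_le_one_left (norm_nonneg _) (er_le i x)

theorem BSupp.of_continuous {N : ℕ} {B : Euc N → ℝ} (hc : Continuous B) (hs : HasCompactSupport B) :
    ∃ M R, BSupp M R B := by
  obtain ⟨M, hM⟩ := hs.exists_bound_of_continuous hc
  obtain ⟨R, hR⟩ := hs.isCompact.isBounded.subset_ball (0 : Euc N)
  refine ⟨M, R, hc.aestronglyMeasurable, hM, fun x hx => ?_⟩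
  by_contra h
  have := hR (subset_tsupport _ h)
  simp at this
  linarith

/-- The radial component of a vector field. -/
def radComp {N : ℕ} (g : Fin N → Euc N → ℝ) (x : Euc N) : ℝ := ∑ j, er j x * g j x

theorem fderiv_apply_sum {N : ℕ} (L : Euc N →L[ℝ] ℝ) (y : Euc N) :
    L y = ∑ j, y j * L (EuclideanSpace.single j 1) := by
  have : y = ∑ j, y j • EuclideanSpace.single j (1:ℝ) := by
    simpa using ((EuclideanSpace.basisFun (Fin N) ℝ).sum_repr y).symm
  conv_lhs => rw [this]
  simp

theorem sph_integrable {N : ℕ} {f : sphere (0 : Euc N) 1 → ℝ} (hf : Continuous f) :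
    Integrable f (sphM N) := by
  have : CompactSpace (sphere (0 : Euc N) 1) := isCompact_iff_compactSpace.1 (isCompact_sphere _ _)
  exact hf.integrable_of_hasCompactSupport (HasCompactSupport.of_compactSpace f)

theorem radS_lineDeriv {N : ℕ} {v : Euc N → ℝ} (hv : ContDiff ℝ 1 v)
    (hs : HasCompactSupport v) (i : Fin N) {x : Euc N} (hx : x ≠ 0) :
    lineDeriv ℝ (radialSymmetrization v) x (EuclideanSpace.single i 1) =
      er i x * radialSymmetrization (radComp fun j y => fderiv ℝ v y (EuclideanSpace.single j 1)) x := by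
  have hx0 : 0 < ‖x‖ := norm_pos_iff.2 hx
  obtain ⟨C, hC⟩ := (hs.fderiv ℝ).exists_bound_of_continuous (hv.continuous_fderiv one_ne_zero)
  set V : ℝ → ℝ := fun r => ∫ σ : sphere (0 : Euc N) 1, v (r • (σ : Euc N)) ∂(sphM N) with hV
  have cfd : Continuous (fderiv ℝ v) := hv.continuous_fderiv one_ne_zero
  have hcont : ∀ r : ℝ, Continuous fun σ : sphere (0 : Euc N) 1 => v (r • (σ : Euc N)) := fun r =>
    hv.continuous.comp (by fun_prop)
  have hVd : HasDerivAt V (∫ σ : sphere (0 : Euc N) 1, fderiv ℝ v (‖x‖ • (σ : Euc N)) σ ∂(sphM N)) ‖x‖ := by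
    refine (hasDerivAt_integral_of_dominated_loc_of_deriv_le (s := Set.univ) (bound := fun _ => C)
      (F' := fun r σ => fderiv ℝ v (r • (σ : Euc N)) σ)
      Filter.univ_mem (Eventually.of_forall fun r => (hcont r).aestronglyMeasurable)
      (sph_integrable (hcont _)) ?_ ?_ (integrable_const _) ?_).2
    · refine Continuous.aestronglyMeasurable ?_
      exact (cfd.comp (by fun_prop)).clm_apply (by fun_prop)
    · refine ae_of_all _ fun σ r _ => ?_
      refine (ContinuousLinearMap.le_opNorm _ _).trans ?_
      rw [norm_eq_of_mem_sphere, mul_one]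
      exact hC _
    · refine ae_of_all _ fun σ r _ => ?_
      have h1 : HasDerivAt (fun r : ℝ => r • (σ : Euc N)) ((1:ℝ) • (σ : Euc N)) r :=
        (hasDerivAt_id r).smul_const _
      rw [one_smul] at h1
      exact ((hv.differentiable one_ne_zero).differentiableAt.hasFDerivAt).comp_hasDerivAt r h1
  have hn : HasDerivAt (fun t : ℝ => ‖x + t • EuclideanSpace.single i (1:ℝ)‖) (er i x) 0 := by
    have hl : HasDerivAt (fun t : ℝ => x + t • EuclideanSpace.single i (1:ℝ))
        (EuclideanSpace.single i (1:ℝ)) 0 := by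
      simpa using ((hasDerivAt_id (0:ℝ)).smul_const (EuclideanSpace.single i (1:ℝ))).const_add x
    have h2 := hl.norm_sq
    have h3 := h2.sqrt (by simpa using hx)
    simp only [Real.sqrt_sq (norm_nonneg _)] at h3
    convert h3 using 1
    simp [er, EuclideanSpace.inner_single_right]
    field_simp
  have hc : HasDerivAt (fun t : ℝ => V ‖x + t • EuclideanSpace.single i (1:ℝ)‖) _ 0 :=
    HasDerivAt.comp (h₂ := V) 0 (by simpa using hVd) hn
  have hd := (hc.const_mul ((N : ℝ) * (volume (ball (0 : Euc N) 1)).toReal)⁻¹).deriv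
  have hL : lineDeriv ℝ (radialSymmetrization v) x (EuclideanSpace.single i 1) =
    deriv (fun t : ℝ => ((N : ℝ) * (volume (ball (0 : Euc N) 1)).toReal)⁻¹ *
      V ‖x + t • EuclideanSpace.single i (1:ℝ)‖) 0 := rfl
  rw [hL, hd, radialSymmetrization]
  have : ∀ σ : sphere (0 : Euc N) 1, radComp (fun j y => fderiv ℝ v y (EuclideanSpace.single j 1))
      (‖x‖ • (σ : Euc N)) = fderiv ℝ v (‖x‖ • (σ : Euc N)) σ := by
    intro σ
    rw [fderiv_apply_sum, radComp]
    refine Finset.sum_congr rfl fun j _ => ?_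
    congr 1
    simp [er, norm_smul, hx0.ne']
  simp only [this]
  ring

theorem radS_lipschitz {N : ℕ} (hN : 1 ≤ N) {v : Euc N → ℝ} {C : NNReal} (hv : LipschitzWith C v) :
    LipschitzWith C (radialSymmetrization v) := by
  have : NeZero (sphM N) := ⟨sphM_ne hN⟩
  refine LipschitzWith.of_dist_le_mul fun x y => ?_
  have hcont : ∀ r : ℝ, Integrable (fun σ : sphere (0 : Euc N) 1 => v (r • (σ : Euc N)))
     (((sphM N) Set.univ)⁻¹ • sphM N) := fun r =>
    (sph_integrable (hv.continuous.comp (by fun_prop))).smul_measure (ENNReal.inv_ne_top.2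
      (by rw [Ne, Measure.measure_univ_eq_zero]; exact sphM_ne hN))
  rw [radS_eq, radS_eq, average, average, dist_eq_norm, ← integral_sub (hcont _) (hcont _)]
  have := norm_integral_le_of_norm_le_const (μ := ((sphM N) Set.univ)⁻¹ • sphM N)
    (f := fun σ : sphere (0 : Euc N) 1 => v (‖x‖ • (σ : Euc N)) - v (‖y‖ • (σ : Euc N)))
    (C := C * dist x y) (ae_of_all _ fun σ => ?_)
  · rwa [probReal_univ, mul_one] at this
  · rw [← dist_eq_norm]
    refine (hv.dist_le_mul _ _).trans ?_
    gcongr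
    rw [dist_eq_norm, ← sub_smul, norm_smul, norm_eq_of_mem_sphere, mul_one, dist_eq_norm]
    exact abs_norm_sub_norm_le x y

theorem radComp_locInt {N : ℕ} {g : Fin N → Euc N → ℝ} (hg : ∀ j, LocallyIntegrable (g j) volume) :
    LocallyIntegrable (radComp g) volume := by
  have : radComp g = ∑ j, fun x => er j x * g j x := by
    funext x; simp [radComp]
  rw [this]
  exact locallyIntegrable_finsetSum' _ fun j _ => er_mul_locInt (hg j) j

/-- The duality identity for radial derivatives. -/
theorem pairing {N : ℕ} (hN : 1 ≤ N) {g : Fin N → Euc N → ℝ}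
    (hg : ∀ j, LocallyIntegrable (g j) volume) {M R : ℝ} {φ : Euc N → ℝ} (hφ : BSupp M R φ)
    (i : Fin N) :
    ∫ x, er i x * radialSymmetrization (radComp g) x * φ x =
      ∑ j, ∫ x, g j x * (er j x * radialSymmetrization (fun y => er i y * φ y) x) := by
  have h1 := radS_adj hN (radComp_locInt hg) (hφ.er_mul i)
  have hb := (hφ.er_mul i).radS hN
  rw [← integral_finsetSum _ fun j _ => (hb.er_mul j).integrable_mul (hg j)]
  calc _ = ∫ x, radialSymmetrization (radComp g) x * (er i x * φ x) := by
        congr 1; funext x; ring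
    _ = _ := h1
    _ = _ := by
        congr 1; funext x
        rw [radComp, Finset.sum_mul]
        refine Finset.sum_congr rfl fun j _ => by ring

theorem smooth_identity {N : ℕ} (hN : 1 ≤ N) {φ v : Euc N → ℝ} (hφ : ContDiff ℝ 1 φ)
    (hφs : HasCompactSupport φ) (hv : ContDiff ℝ 1 v) (hvs : HasCompactSupport v) (i : Fin N) :
    ∫ x, v x * radialSymmetrization (fun y => fderiv ℝ φ y (EuclideanSpace.single i 1)) x =
      - ∑ j, ∫ x, fderiv ℝ v x (EuclideanSpace.single j 1) *
        (er j x * radialSymmetrization (fun y => er i y * φ y) x) := by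
  have := euc_nontrivial hN
  obtain ⟨C, hC⟩ := ContDiff.lipschitzWith_of_hasCompactSupport hvs hv one_ne_zero
  obtain ⟨D, hD⟩ := ContDiff.lipschitzWith_of_hasCompactSupport hφs hφ one_ne_zero
  obtain ⟨M, R, hB⟩ := BSupp.of_continuous hφ.continuous hφs
  have hcd : ∀ {w : Euc N → ℝ}, ContDiff ℝ 1 w → ∀ j : Fin N,
      Continuous fun y => fderiv ℝ w y (EuclideanSpace.single j 1) := fun hw j =>
    (hw.continuous_fderiv one_ne_zero).clm_apply continuous_const
  obtain ⟨M', R', hB'⟩ := BSupp.of_continuous (hcd hφ i)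
    (hφs.fderiv_apply (𝕜 := ℝ) (EuclideanSpace.single i 1))
  have hl := LipschitzWith.integral_lineDeriv_mul_eq (μ := volume) (radS_lipschitz hN hC) hD hφs
    (EuclideanSpace.single i (1:ℝ))
  rw [← radS_adj hN hv.continuous.locallyIntegrable hB',
    ← pairing hN (fun j => (hcd hv j).locallyIntegrable) hB i]
  have e1 : ∫ x, lineDeriv ℝ (radialSymmetrization v) x (EuclideanSpace.single i (1:ℝ)) * φ x =
      ∫ x, er i x * radialSymmetrization
        (radComp fun j y => fderiv ℝ v y (EuclideanSpace.single j 1)) x * φ x := by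
    refine integral_congr_ae ?_
    filter_upwards [Measure.ae_ne volume (0 : Euc N)] with x hx
    rw [radS_lineDeriv hv hvs i hx]
  rw [← e1, hl, ← integral_neg]
  congr 1; funext x
  rw [(hφ.differentiable one_ne_zero).differentiableAt.lineDeriv_eq_fderiv, map_neg]
  ring

open scoped Convolution in
/-- Convolution of `ψ` with `f`. -/
abbrev mconv {N : ℕ} (ψ f : Euc N → ℝ) : Euc N → ℝ :=
  ψ ⋆[ContinuousLinearMap.lsmul ℝ ℝ, (volume : Measure (Euc N))] f

theorem mconv_contDiff {N : ℕ} {ψ f : Euc N → ℝ} (hψ : ContDiff ℝ (⊤ : ℕ∞) ψ)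
    (hψs : HasCompactSupport ψ) (hf : LocallyIntegrable f volume) :
    ContDiff ℝ (⊤ : ℕ∞) (mconv ψ f) :=
  hψs.contDiff_convolution_left _ hψ hf

theorem mconv_fderiv {N : ℕ} {ψ f : Euc N → ℝ} (hψ : ContDiff ℝ (⊤ : ℕ∞) ψ)
    (hψs : HasCompactSupport ψ) (hf : LocallyIntegrable f volume) (x e : Euc N) :
    fderiv ℝ (mconv ψ f) x e = ∫ t, fderiv ℝ ψ (x - t) e * f t := by
  have h1 : ContDiff ℝ 1 ψ := hψ.of_le (by norm_cast)
  have h := hψs.hasFDerivAt_convolution_left (ContinuousLinearMap.lsmul ℝ ℝ) h1 hf x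
  have hc : Continuous (fderiv ℝ ψ) := h1.continuous_fderiv one_ne_zero
  have hex := (hψs.fderiv ℝ).convolutionExists_left
    ((ContinuousLinearMap.lsmul ℝ ℝ : ℝ →L[ℝ] ℝ →L[ℝ] ℝ).precompL (Euc N)) hc hf x
  rw [h.fderiv, convolution_eq_swap, ContinuousLinearMap.integral_apply]
  · rfl
  · exact hex.integrable_swap

theorem mconv_BSupp {N : ℕ} {M R : ℝ} {f : Euc N → ℝ} (hM : 0 ≤ M) (hf : BSupp M R f)
    (b : ContDiffBump (0 : Euc N)) (hb : b.rOut ≤ 1) :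
    BSupp M (R + 1) (mconv (b.normed volume) f) := by
  refine ⟨((mconv_contDiff b.contDiff_normed b.hasCompactSupport_normed
    hf.locInt).continuous).aestronglyMeasurable, fun x => ?_, fun x hx => ?_⟩
  · have := dist_convolution_le (μ := volume) (f := b.normed volume) (g := f) (x₀ := x) (z₀ := (0:ℝ))
      hM b.support_normed_eq.subset b.nonneg_normed b.integral_normed hf.meas
      (fun y _ => by simpa using hf.bd y)
    simpa using this
  · have : ∀ t, b.normed volume (x - t) • f t = 0 := by
      intro t
      by_cases ht : R ≤ ‖t‖
      · simp [hf.supp t ht]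
      · have : x - t ∉ Function.support (b.normed (volume : Measure (Euc N))) := by
          rw [b.support_normed_eq]
          simp only [mem_ball, dist_zero_right, not_lt]
          have := norm_sub_norm_le x t
          linarith
        simp [Function.notMem_support.1 this]
    rw [mconv, convolution_lsmul_swap]
    simp only [this, integral_zero]

theorem BSupp.mono {N : ℕ} {M R M' R' : ℝ} {f : Euc N → ℝ} (hf : BSupp M R f) (h1 : M ≤ M')
    (h2 : R ≤ R') : BSupp M' R' f :=
  ⟨hf.meas, fun x => (hf.bd x).trans h1, fun x hx => hf.supp x (h2.trans hx)⟩

theorem BSupp.hcs {N : ℕ} {M R : ℝ} {f : Euc N → ℝ} (hf : BSupp M R f) : HasCompactSupport f := by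
  refine HasCompactSupport.of_support_subset_isCompact (isCompact_closedBall (0 : Euc N) R) ?_
  intro x hx
  by_contra hc
  simp only [mem_closedBall, dist_zero_right, not_le] at hc
  exact hx (hf.supp x hc.le)

theorem mconv_tendsto {N : ℕ} {M R : ℝ} {f u : Euc N → ℝ} (hM : 0 ≤ M) (hf : BSupp M R f)
    (hu : LocallyIntegrable u volume) {b : ℕ → ContDiffBump (0 : Euc N)}
    (hb : ∀ n, (b n).rOut ≤ 1) (hb0 : Tendsto (fun n => (b n).rOut) atTop (𝓝 0))
    (hb2 : ∀ n, (b n).rOut ≤ 2 * (b n).rIn) :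
    Tendsto (fun n => ∫ x, u x * mconv ((b n).normed volume) f x) atTop (𝓝 (∫ x, u x * f x)) := by
  have hB := fun n => mconv_BSupp hM hf (b n) (hb n)
  refine tendsto_integral_of_dominated_convergence
    (fun x => ‖u x * (closedBall (0 : Euc N) (R+1)).indicator (fun _ => M) x‖) ?_ ?_ ?_ ?_
  · exact fun n => ((hB n).integrable_mul hu).aestronglyMeasurable
  · have : BSupp M (R+2) ((closedBall (0 : Euc N) (R+1)).indicator (fun _ => M)) := by
      refine ⟨(measurable_const.indicator isClosed_closedBall.measurableSet).aestronglyMeasurable,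
        fun x => ?_, fun x hx => ?_⟩
      · by_cases h : x ∈ closedBall (0 : Euc N) (R+1) <;> simp [Set.indicator, h, abs_of_nonneg, hM]
      · refine Set.indicator_of_notMem ?_ _
        simp; linarith
    exact (this.integrable_mul hu).norm
  · intro n
    refine ae_of_all _ fun x => ?_
    rw [norm_mul, norm_mul]
    gcongr
    by_cases h : x ∈ closedBall (0 : Euc N) (R+1)
    · rw [Set.indicator_of_mem h, Real.norm_of_nonneg hM]
      exact (hB n).bd x
    · have h' : R + 1 ≤ ‖x‖ := by simp at h; linarith
      rw [(hB n).supp x h']; simp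
  · filter_upwards [ContDiffBump.ae_convolution_tendsto_right_of_locallyIntegrable (μ := volume)
      hb0 (Eventually.of_forall hb2) hf.locInt] with x hx
    exact hx.const_mul _

theorem extend_test {N : ℕ} {u : Euc N → ℝ} {g : Fin N → Euc N → ℝ}
    (hu : ∀ i, IsWeakPartialDeriv i u (g i)) (huL : LocallyIntegrable u volume)
    {M R : ℝ} (hM : 0 ≤ M) {D : Euc N → ℝ} {F : Fin N → Euc N → ℝ}
    (hD : BSupp M R D) (hF : ∀ j, BSupp M R (F j))
    (hv : ∀ v : Euc N → ℝ, ContDiff ℝ (⊤ : ℕ∞) v → HasCompactSupport v →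
      ∫ x, v x * D x = - ∑ j, ∫ x, fderiv ℝ v x (EuclideanSpace.single j 1) * F j x) :
    ∫ x, u x * D x = - ∑ j, ∫ x, g j x * F j x := by
  let b : ℕ → ContDiffBump (0 : Euc N) := fun n =>
    ⟨1 / (2 * ((n : ℝ) + 1)), 1 / ((n : ℝ) + 1), by positivity, by
      apply one_div_lt_one_div_of_lt <;> linarith [(Nat.cast_nonneg n : (0:ℝ) ≤ n)]⟩
  have hb : ∀ n, (b n).rOut ≤ 1 := fun n => by
    show 1 / ((n : ℝ) + 1) ≤ 1
    rw [div_le_one (by positivity)]; linarith [(Nat.cast_nonneg n : (0:ℝ) ≤ n)]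
  have hb0 : Tendsto (fun n => (b n).rOut) atTop (𝓝 0) := tendsto_one_div_add_atTop_nhds_zero_nat
  have hb2 : ∀ n, (b n).rOut ≤ 2 * (b n).rIn := fun n => by
    show 1 / ((n : ℝ) + 1) ≤ 2 * (1 / (2 * ((n : ℝ) + 1)))
    apply le_of_eq; field_simp
  have t1 := mconv_tendsto hM hD huL hb hb0 hb2
  have t2 : Tendsto (fun n => - ∑ j, ∫ x, g j x * mconv ((b n).normed volume) (F j) x) atTop
      (𝓝 (- ∑ j, ∫ x, g j x * F j x)) :=
    (tendsto_finsetSum _ fun j _ => mconv_tendsto hM (hF j) (hu j).2.1 hb hb0 hb2).neg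
  refine tendsto_nhds_unique t1 (t2.congr fun n => ?_)
  set ψ := (b n).normed (volume : Measure (Euc N)) with hψdef
  have hψ : ContDiff ℝ (⊤ : ℕ∞) ψ := (b n).contDiff_normed
  have hψs : HasCompactSupport ψ := (b n).hasCompactSupport_normed
  have hw : ∀ j, ∫ x, u x * fderiv ℝ (mconv ψ (F j)) x (EuclideanSpace.single j 1) =
      - ∫ x, g j x * mconv ψ (F j) x := by
    intro j
    have := (hu j).2.2 (mconv ψ (F j)) (mconv_contDiff hψ hψs (hF j).locInt)
      (mconv_BSupp hM (hF j) (b n) (hb n)).hcs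
    simpa [pderivList] using this
  rw [← Finset.sum_neg_distrib]
  simp only [← hw]
  rw [← integral_finsetSum]
  · congr 1; funext x
    rw [← Finset.mul_sum]
    congr 1
    have hsub : ContDiff ℝ (⊤ : ℕ∞) fun t : Euc N => x - t := by fun_prop
    have := hv (fun t => ψ (x - t)) (hψ.comp hsub)
      (hψs.comp_homeomorph (Homeomorph.subLeft x))
    rw [mconv, convolution_lsmul_swap]
    simp only [smul_eq_mul]
    rw [this, ← Finset.sum_neg_distrib]
    refine Finset.sum_congr rfl fun j _ => ?_
    rw [mconv_fderiv hψ hψs (hF j).locInt, ← integral_neg]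
    congr 1; funext t
    have : fderiv ℝ (fun t => ψ (x - t)) t = - fderiv ℝ ψ (x - t) := by
      have hd : DifferentiableAt ℝ ψ (x - t) := (hψ.differentiable (by simp)).differentiableAt
      have h2 : HasFDerivAt (fun t : Euc N => x - t) (-(ContinuousLinearMap.id ℝ (Euc N))) t :=
        (hasFDerivAt_id t).const_sub x
      have h3 := (hd.hasFDerivAt.comp t h2).fderiv
      rw [Function.comp_def] at h3
      rw [h3]; ext y; simp
    rw [this]; simp
  · intro j _
    have hc := mconv_contDiff hψ hψs (hF j).locInt
    exact huL.integrable_smul_right_of_hasCompactSupport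
      ((hc.continuous_fderiv (by simp)).clm_apply continuous_const)
      ((mconv_BSupp hM (hF j) (b n) (hb n)).hcs.fderiv_apply (𝕜 := ℝ) _)

theorem weak_radS {N : ℕ} (hN : 1 ≤ N) {u : Euc N → ℝ} {g : Fin N → Euc N → ℝ}
    (hu : ∀ i, IsWeakPartialDeriv i u (g i)) (i : Fin N) :
    IsWeakPartialDeriv i (radialSymmetrization u)
      (fun x => er i x * radialSymmetrization (radComp g) x) := by
  have huL : LocallyIntegrable u volume := (hu i).1
  refine ⟨radS_locInt hN huL, er_mul_locInt (radS_locInt hN (radComp_locInt fun j => (hu j).2.1)) i,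
    fun φ hφ hφs => ?_⟩
  have h1 : ContDiff ℝ 1 φ := hφ.of_le (by norm_cast)
  obtain ⟨M, R, hB⟩ := BSupp.of_continuous hφ.continuous hφs
  obtain ⟨M', R', hB'⟩ := BSupp.of_continuous
    (B := fun y => fderiv ℝ φ y (EuclideanSpace.single i 1))
    ((h1.continuous_fderiv one_ne_zero).clm_apply continuous_const)
    (hφs.fderiv_apply (𝕜 := ℝ) (EuclideanSpace.single i 1))
  have hM : 0 ≤ M := (abs_nonneg _).trans (hB.bd 0)
  have hD := (hB'.radS hN).mono (le_max_right M M') (le_max_right R R')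
  have hF := fun j => (((hB.er_mul i).radS hN).er_mul j).mono (le_max_left M M') (le_max_left R R')
  have key := extend_test hu huL (hM.trans (le_max_left M M')) hD hF
    (fun v hv hvs => smooth_identity hN h1 hφs (hv.of_le (by norm_cast)) hvs i)
  have hadj := radS_adj hN huL hB'
  have hp := pairing hN (fun j => (hu j).2.1) hB i
  simp only [pderivList, List.length_singleton, pow_one, neg_mul, one_mul]
  rw [hadj, key, hp]

theorem gradNorm1_S_le {N : ℕ} (a : ℝ) (x : Euc N) :
    Real.sqrt (∑ i, (er i x * a) ^ 2) ≤ |a| := by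
  simp only [mul_pow, ← Finset.sum_mul]
  rw [← Real.sqrt_sq_eq_abs]
  exact Real.sqrt_le_sqrt (mul_le_of_le_one_left (sq_nonneg a) (sum_er_sq_le x))

theorem abs_radComp_le {N : ℕ} (g : Fin N → Euc N → ℝ) (x : Euc N) :
    |radComp g x| ≤ gradNorm1 g x := by
  rw [← Real.sqrt_sq_eq_abs, gradNorm1]
  refine Real.sqrt_le_sqrt ?_
  refine (Finset.sum_mul_sq_le_sq_mul_sq Finset.univ (fun j => er j x) (fun j => g j x)).trans ?_
  exact mul_le_of_le_one_left (Finset.sum_nonneg fun _ _ => sq_nonneg _) (sum_er_sq_le x)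

theorem gradNorm1_nonneg {N : ℕ} (g : Fin N → Euc N → ℝ) (x : Euc N) : 0 ≤ gradNorm1 g x :=
  Real.sqrt_nonneg _

theorem gradNorm1_le_sum {N : ℕ} (g : Fin N → Euc N → ℝ) (x : Euc N) :
    gradNorm1 g x ≤ ∑ i, |g i x| := by
  rw [gradNorm1, Real.sqrt_le_left (Finset.sum_nonneg fun _ _ => abs_nonneg _)]
  have := Finset.sum_sq_le_sq_sum_of_nonneg (s := Finset.univ) (f := fun i => |g i x|)
    (fun _ _ => abs_nonneg _)
  simpa using this

theorem wt_nonneg {N : ℕ} (s : ℝ) (q : ℝ≥0∞) (x : Euc N) : 0 ≤ wt N s q x := by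
  unfold wt; positivity

theorem wt_meas {N : ℕ} (s : ℝ) (q : ℝ≥0∞) : Measurable (wt N s q) := by
  unfold wt; fun_prop

/-- Lemma 6. If `∇u ∈ (L^p_s)^N`, then the radial symmetrization
`u_S` of `u` satisfies `∇u_S ∈ (L^p_s)^N` and `‖|∇u_S|‖_{L^p_s} ≤ ‖|∇u|‖_{L^p_s}`. -/
theorem stmt_9 {N : ℕ} (hN : 1 ≤ N) (s p : ℝ) (hp : 1 ≤ p) :
    ∀ (u : Euc N → ℝ) (g : Fin N → Euc N → ℝ),
      (∀ i, IsWeakPartialDeriv i u (g i)) →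
      (∀ i, MemLs N s (ENNReal.ofReal p) (g i)) →
      ∃ gS : Fin N → Euc N → ℝ,
        (∀ i, IsWeakPartialDeriv i (radialSymmetrization u) (gS i)) ∧
        (∀ i, MemLs N s (ENNReal.ofReal p) (gS i)) ∧
        LsNorm N s (ENNReal.ofReal p) (gradNorm1 gS)
          ≤ LsNorm N s (ENNReal.ofReal p) (gradNorm1 g) := by
  intro u g hu hg
  set q := ENNReal.ofReal p with hq
  have hgL : LocallyIntegrable (radComp g) volume := radComp_locInt fun j => (hu j).2.1
  have hwm : AEStronglyMeasurable (fun x => wt N s q x * radComp g x) volume :=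
    (wt_meas s q).aestronglyMeasurable.mul hgL.aestronglyMeasurable
  have hsum : MemLp (fun x => ∑ i, ‖wt N s q x * g i x‖) q volume :=
    memLp_finsetSum _ fun i _ => (hg i).norm
  have hfin : eLpNorm (fun x => wt N s q x * gradNorm1 g x) q volume < ⊤ := by
    refine lt_of_le_of_lt (eLpNorm_mono fun x => ?_) hsum.2
    rw [Real.norm_of_nonneg (mul_nonneg (wt_nonneg s q x) (gradNorm1_nonneg g x)),
      Real.norm_of_nonneg (Finset.sum_nonneg fun _ _ => norm_nonneg _)]
    simp only [norm_mul, ← Finset.mul_sum, Real.norm_of_nonneg (wt_nonneg s q x)]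
    exact mul_le_mul_of_nonneg_left (gradNorm1_le_sum g x) (wt_nonneg s q x)
  have hSw : (fun x => wt N s q x * radialSymmetrization (radComp g) x) =
      radialSymmetrization (fun x => wt N s q x * radComp g x) := by
    funext x
    exact (radS_mul_radial (fun r => (1 + r) ^ (-s - (N : ℝ) / q.toReal)) (radComp g) x).symm
  have hle : eLpNorm (fun x => wt N s q x * radialSymmetrization (radComp g) x) q volume ≤
      eLpNorm (fun x => wt N s q x * gradNorm1 g x) q volume := by
    rw [hSw]
    refine (radS_eLpNorm hN hwm hp).trans (eLpNorm_mono fun x => ?_)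
    rw [norm_mul, norm_mul]
    refine mul_le_mul_of_nonneg_left ?_ (norm_nonneg _)
    exact (abs_radComp_le g x).trans (le_abs_self _)
  have hSm : AEStronglyMeasurable (radialSymmetrization (radComp g)) volume :=
    radS_aesm hN hgL.aestronglyMeasurable
  refine ⟨fun i x => er i x * radialSymmetrization (radComp g) x, fun i => weak_radS hN hu i,
    fun i => ⟨?_, ?_⟩, ?_⟩
  · exact (wt_meas s q).aestronglyMeasurable.mul ((er_meas i).aestronglyMeasurable.mul hSm)
  · refine lt_of_le_of_lt (eLpNorm_mono fun x => ?_) (hle.trans_lt hfin)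
    rw [norm_mul, norm_mul, norm_mul]
    refine mul_le_mul_of_nonneg_left ?_ (norm_nonneg _)
    exact mul_le_of_le_one_left (norm_nonneg _) (er_le i x)
  · refine ENNReal.toReal_mono hfin.ne (le_trans (eLpNorm_mono fun x => ?_) hle)
    rw [norm_mul, norm_mul]
    refine mul_le_mul_of_nonneg_left ?_ (norm_nonneg _)
    rw [Real.norm_of_nonneg (gradNorm1_nonneg _ x)]
    exact gradNorm1_S_le _ x

end
end

section
/- Suppose N > 1, let a ∈ ℝ and 1 ≤ p < ∞, and let u ∈ L^1_loc(ℝ^N) satisfy u_S = 0, |x|^{a/p} u ∈ L^p(ℝ^N) and |x|^{1+a/p} ∇u ∈ (L^p(ℝ^N))^N. Then for every q ∈ I_{1,p} there is a constant C = C(a,p,q) > 0 independent of u such that || |x|^{(a+N)/p - N/q} u ||_{L^q} ≤ C || |x|^{1+a/p} |∇u| ||_{L^p}. Furthermore, if p > N, then lim_{|x|→∞} |x|^{(a+N)/p} u(x) = 0. -/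
open MeasureTheory Metric Filter Topology ENNReal

noncomputable section

theorem jensen_pow {α : Type*} [MeasurableSpace α] (μ : Measure α) (f : α → ℝ≥0∞)
    (hf : AEMeasurable f μ) {p : ℝ} (hp : 1 ≤ p) :
    (∫⁻ x, f x ∂μ) ^ p ≤ μ Set.univ ^ (p - 1) * ∫⁻ x, f x ^ p ∂μ := by
  rcases hp.eq_or_lt with rfl | hp1
  · simp
  have hpq := Real.HolderConjugate.conjExponent hp1
  have h := ENNReal.lintegral_mul_le_Lp_mul_Lq μ hpq hf (aemeasurable_const (b := (1 : ℝ≥0∞)))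
  simp only [Pi.mul_apply, mul_one, ENNReal.one_rpow, lintegral_const, one_mul] at h
  have h2 := ENNReal.rpow_le_rpow h (by linarith : 0 ≤ p)
  rw [ENNReal.mul_rpow_of_nonneg _ _ (by linarith), ← ENNReal.rpow_mul, ← ENNReal.rpow_mul,
    one_div_mul_cancel (by linarith), ENNReal.rpow_one, mul_comm] at h2
  convert h2 using 3
  have := hpq.sub_one_ne_zero
  rw [Real.conjExponent]
  field_simp

/-- mollification estimate. -/
theorem moll_est {N : ℕ} (φ : ContDiffBump (0 : Euc N)) (f h : Euc N → ℝ≥0∞)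
    (hf : AEMeasurable f volume) {p : ℝ} (hp : 1 ≤ p) {B B' : Set (Euc N)}
    (hB : MeasurableSet B) (hB' : MeasurableSet B')
    (hh : ∀ x, h x ≤ ∫⁻ t, ‖φ.normed volume t‖ₑ * f (x - t))
    (hBB : ∀ x ∈ B, ∀ t, ‖t‖ < φ.rOut → x - t ∈ B') :
    ∫⁻ x in B, h x ^ p ≤ ∫⁻ x in B', f x ^ p := by
  have hηc : Continuous (φ.normed (volume : Measure (Euc N))) := φ.continuous_normed
  have hηm : Measurable (fun t => ‖φ.normed (volume : Measure (Euc N)) t‖ₑ) :=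
    hηc.enorm.measurable
  set ν : Measure (Euc N) := volume.withDensity (fun t => ‖φ.normed (volume : Measure (Euc N)) t‖ₑ)
    with hν
  have hIntg : ∫⁻ t, ‖φ.normed (volume : Measure (Euc N)) t‖ₑ = 1 := by
    have h1 := φ.integral_normed (μ := (volume : Measure (Euc N)))
    have h2 : ∫⁻ t, ‖φ.normed (volume : Measure (Euc N)) t‖ₑ
        = ∫⁻ t, ENNReal.ofReal (φ.normed (volume : Measure (Euc N)) t) := by
      refine lintegral_congr fun t => ?_
      rw [Real.enorm_eq_ofReal (φ.nonneg_normed t)]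
    rw [h2, ← ofReal_integral_eq_lintegral_ofReal φ.integrable_normed
      (ae_of_all _ fun t => φ.nonneg_normed t), h1, ENNReal.ofReal_one]
  have hprob : ν Set.univ = 1 := by
    rw [hν, withDensity_apply _ MeasurableSet.univ]; simpa using hIntg
  have : IsProbabilityMeasure ν := ⟨hprob⟩
  set f' := hf.mk f with hf'
  have hf'm : Measurable f' := hf.measurable_mk
  have hff : f =ᵐ[volume] f' := hf.ae_eq_mk
  have step1 : ∀ x, h x ≤ ∫⁻ t, f' (x - t) ∂ν := by
    intro x
    refine (hh x).trans ?_
    have hm1 : Measurable (fun t => f' (x - t)) := hf'm.comp (measurable_const.sub measurable_id)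
    rw [hν, lintegral_withDensity_eq_lintegral_mul _ hηm hm1]
    refine le_of_eq (lintegral_congr_ae ?_)
    have := (Measure.measurePreserving_sub_left (volume : Measure (Euc N)) x).quasiMeasurePreserving.ae_eq_comp hff
    filter_upwards [this] with t ht
    simp only [Function.comp] at ht
    simp [ht]
  have step2 : ∀ x, h x ^ p ≤ ∫⁻ t, f' (x - t) ^ p ∂ν := by
    intro x
    refine (ENNReal.rpow_le_rpow (step1 x) (by linarith)).trans ?_
    refine (jensen_pow ν _ (hf'm.comp (measurable_const.sub measurable_id)).aemeasurable hp).trans ?_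
    rw [hprob]; simp
  calc ∫⁻ x in B, h x ^ p ≤ ∫⁻ x in B, ∫⁻ t, f' (x - t) ^ p ∂ν := lintegral_mono fun x => step2 x
    _ = ∫⁻ t, (∫⁻ x in B, f' (x - t) ^ p) ∂ν := by
        refine lintegral_lintegral_swap ?_
        exact ((hf'm.comp (measurable_fst.sub measurable_snd)).pow_const p).aemeasurable
    _ ≤ ∫⁻ _t, (∫⁻ x in B', f' x ^ p) ∂ν := by
        have hsupp : ∀ᵐ t ∂ν, ‖t‖ < φ.rOut := by
          rw [hν, ae_withDensity_iff hηm]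
          refine ae_of_all _ fun t ht => ?_
          have : t ∈ Function.support (φ.normed (volume : Measure (Euc N))) := by
            simpa using ht
          rw [φ.support_normed_eq] at this
          simpa using this
        refine lintegral_mono_ae ?_
        filter_upwards [hsupp] with t ht
        have e1 : ∫⁻ x in B', f' x ^ p = ∫⁻ x, B'.indicator (fun x => f' x ^ p) (x - t) := by
          rw [lintegral_sub_right_eq_self (fun x => B'.indicator (fun x => f' x ^ p) x) t,
            lintegral_indicator hB']
        rw [e1]
        refine (setLIntegral_mono' hB ?_).trans (setLIntegral_le_lintegral _ _)
        intro x hx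
        rw [Set.indicator_of_mem (hBB x hx t ht)]
    _ = ∫⁻ x in B', f x ^ p := by
        rw [lintegral_const, hprob, mul_one]
        refine setLIntegral_congr_fun_ae hB' ?_
        filter_upwards [hff] with x hx _
        rw [hx]

/-- gradient of the mollified function -/
theorem moll_fderiv {N : ℕ} (φ : ContDiffBump (0 : Euc N)) (u : Euc N → ℝ)
    (g : Fin N → Euc N → ℝ) (hN : 0 < N) (hg : ∀ i, IsWeakPartialDeriv i u (g i)) (x : Euc N) :
    ‖fderiv ℝ (convolution (φ.normed volume) u (ContinuousLinearMap.lsmul ℝ ℝ) volume) x‖ₑ ≤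
      ∫⁻ t, ‖φ.normed volume t‖ₑ * ‖gradNorm1 g (x - t)‖ₑ := by
  set η := φ.normed (volume : Measure (Euc N)) with hη
  have hηcd : ContDiff ℝ (⊤ : ℕ∞) η := φ.contDiff_normed
  have hηs : HasCompactSupport η := φ.hasCompactSupport_normed
  have hu : LocallyIntegrable u volume := (hg ⟨0, hN⟩).1
  have hgl : ∀ i, LocallyIntegrable (g i) volume := fun i => (hg i).2.1
  have hD := HasCompactSupport.hasFDerivAt_convolution_left (ContinuousLinearMap.lsmul ℝ ℝ)
    hηs (hηcd.of_le (by exact_mod_cast le_top)) hu x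
  rw [hD.fderiv]
  -- partial derivatives
  have hpart : ∀ i, ((convolution (fderiv ℝ η) u
      (ContinuousLinearMap.precompL (Euc N) (ContinuousLinearMap.lsmul ℝ ℝ)) volume) x)
        (EuclideanSpace.single i 1) = ∫ y, g i y * η (x - y) := by
    intro i
    have hex : ConvolutionExistsAt (fderiv ℝ η) u x
        (ContinuousLinearMap.precompL (Euc N) (ContinuousLinearMap.lsmul ℝ ℝ)) volume :=
      (HasCompactSupport.convolutionExists_left _ (hηs.fderiv ℝ)
        (hηcd.continuous_fderiv (by simp)) hu) x
    rw [convolution_def, ContinuousLinearMap.integral_apply hex]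
    simp only [ContinuousLinearMap.precompL_apply, ContinuousLinearMap.lsmul_apply]
    have hw := (hg i).2.2 (fun y => η (x - y)) (hηcd.comp (contDiff_const.sub contDiff_id))
      (hηs.comp_homeomorph (Homeomorph.subLeft x))
    simp only [pderivList, List.length_singleton, pow_one, neg_mul, one_mul] at hw
    have hd : ∀ y, fderiv ℝ (fun y => η (x - y)) y (EuclideanSpace.single i 1)
        = - (fderiv ℝ η (x - y) (EuclideanSpace.single i 1)) := by
      intro y
      have h1 : HasFDerivAt (fun y => η (x - y))
          ((fderiv ℝ η (x - y)).comp (-ContinuousLinearMap.id ℝ (Euc N))) y := by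
        refine HasFDerivAt.comp y
          ((hηcd.differentiable (by simp)) (x - y)).hasFDerivAt ?_
        simpa using (hasFDerivAt_id y).const_sub x
      rw [h1.fderiv]; simp
    simp only [hd, mul_neg, integral_neg, neg_inj] at hw
    rw [← hw, ← integral_sub_left_eq_self _ volume x]
    refine integral_congr_ae (ae_of_all _ fun t => ?_)
    simp [mul_comm]
  have hintg : ∀ i, Integrable (fun y => g i y * η (x - y)) volume := by
    intro i
    have := (hgl i).integrable_smul_right_of_hasCompactSupport (g := fun y => η (x - y)) ?_ ?_
    · simpa using this
    · exact hηcd.continuous.comp (continuous_const.sub continuous_id)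
    · exact hηs.comp_homeomorph (Homeomorph.subLeft x)
  have hGm : AEStronglyMeasurable (gradNorm1 g) volume := by
    unfold gradNorm1
    have : AEStronglyMeasurable (fun x => ∑ i, g i x ^ 2) volume := by
      have := Finset.aestronglyMeasurable_fun_sum Finset.univ
        (f := fun i x => g i x ^ 2) (μ := (volume : Measure (Euc N)))
        (fun i _ => (hgl i).aestronglyMeasurable.pow 2)
      exact this
    exact Real.continuous_sqrt.comp_aestronglyMeasurable this
  have hchange : ∫⁻ t, ‖η t‖ₑ * ‖gradNorm1 g (x - t)‖ₑ
      = ∫⁻ y, ‖gradNorm1 g y * η (x - y)‖ₑ := by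
    rw [← lintegral_sub_left_eq_self _ x]
    refine lintegral_congr fun t => ?_
    simp [enorm_mul, mul_comm]
  rw [hchange]
  set L := ((convolution (fderiv ℝ η) u
      (ContinuousLinearMap.precompL (Euc N) (ContinuousLinearMap.lsmul ℝ ℝ)) volume) x) with hL
  refine ContinuousLinearMap.opENorm_le_bound _ fun v => ?_
  have hv : L v = ∫ y, (∑ i, v i * g i y) * η (x - y) := by
    have hvs : v = ∑ i, v i • EuclideanSpace.single i (1 : ℝ) := by
      have := (EuclideanSpace.basisFun (Fin N) ℝ).sum_repr v
      simpa using this.symm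
    conv_lhs => rw [hvs]
    rw [map_sum]
    simp only [map_smul, hpart, smul_eq_mul]
    simp only [Finset.sum_mul]
    rw [integral_finset_sum]
    · refine Finset.sum_congr rfl fun i _ => ?_
      rw [← integral_const_mul]
      simp only [mul_assoc]
    · intro i _
      simpa [mul_assoc] using (hintg i).const_mul (v i)
  rw [hv]
  refine (enorm_integral_le_lintegral_enorm _).trans ?_
  rw [mul_comm, ← lintegral_const_mul'' ]
  · refine lintegral_mono fun y => ?_
    simp only [enorm_mul]
    rw [← mul_assoc]
    refine mul_le_mul_left ?_ _
    rw [← ofReal_norm_eq_enorm v, ← ofReal_norm_eq_enorm (gradNorm1 g y), ← ofReal_norm_eq_enorm,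
      ← ENNReal.ofReal_mul (norm_nonneg _)]
    refine ENNReal.ofReal_le_ofReal ?_
    rw [Real.norm_eq_abs, Real.norm_eq_abs, gradNorm1, abs_of_nonneg (Real.sqrt_nonneg _),
      EuclideanSpace.norm_eq, ← Real.sqrt_mul (Finset.sum_nonneg fun i _ => by positivity)]
    refine Real.abs_le_sqrt ?_
    simpa using Finset.sum_mul_sq_le_sq_mul_sq Finset.univ (fun i => v i) (fun i => g i y)
  · exact (hGm.mul (hηcd.continuous.comp
      (continuous_const.sub continuous_id)).aestronglyMeasurable).enorm

theorem moll_seq {N : ℕ} (hN : 0 < N) (u : Euc N → ℝ) (g : Fin N → Euc N → ℝ)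
    (hg : ∀ i, IsWeakPartialDeriv i u (g i)) (δ : ℝ) (hδ : 0 < δ) :
    ∃ w : ℕ → Euc N → ℝ, (∀ n, ContDiff ℝ 1 (w n)) ∧
      (∀ᵐ x, Tendsto (fun n => w n x) atTop (𝓝 (u x))) ∧
      ∀ (p : ℝ), 1 ≤ p → ∀ B B' : Set (Euc N), MeasurableSet B → MeasurableSet B' →
        (∀ x ∈ B, ∀ t : Euc N, ‖t‖ < δ → x - t ∈ B') → ∀ n,
        ∫⁻ x in B, ‖w n x‖ₑ ^ p ≤ ∫⁻ x in B', ‖u x‖ₑ ^ p ∧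
        ∫⁻ x in B, ‖fderiv ℝ (w n) x‖ₑ ^ p ≤ ∫⁻ x in B', ‖gradNorm1 g x‖ₑ ^ p := by
  have hu : LocallyIntegrable u volume := (hg ⟨0, hN⟩).1
  have hgl : ∀ i, LocallyIntegrable (g i) volume := fun i => (hg i).2.1
  have hGm : AEStronglyMeasurable (gradNorm1 g) volume := by
    unfold gradNorm1
    have : AEStronglyMeasurable (fun x => ∑ i, g i x ^ 2) volume := by
      have := Finset.aestronglyMeasurable_fun_sum Finset.univ
        (f := fun i x => g i x ^ 2) (μ := (volume : Measure (Euc N)))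
        (fun i _ => (hgl i).aestronglyMeasurable.pow 2)
      exact this
    exact Real.continuous_sqrt.comp_aestronglyMeasurable this
  let φ : ℕ → ContDiffBump (0 : Euc N) := fun n =>
    ⟨δ / (n + 2) / 2, δ / (n + 2), by positivity, half_lt_self (by positivity)⟩
  have hr : ∀ n, (φ n).rOut = δ / (n + 2) := fun n => rfl
  have hrle : ∀ n, (φ n).rOut ≤ δ := fun n => by
    rw [hr]; apply div_le_self hδ.le; linarith [n.cast_nonneg (α := ℝ)]
  refine ⟨fun n => convolution ((φ n).normed volume) u (ContinuousLinearMap.lsmul ℝ ℝ) volume,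
    fun n => ?_, ?_, ?_⟩
  · exact ((φ n).hasCompactSupport_normed).contDiff_convolution_left _
      (φ n).contDiff_normed hu
  · refine ContDiffBump.ae_convolution_tendsto_right_of_locallyIntegrable (K := 2) ?_ ?_ hu
    · simp only [hr]
      refine tendsto_const_nhds.div_atTop ?_
      exact tendsto_atTop_add_const_right _ _ tendsto_natCast_atTop_atTop
    · refine Eventually.of_forall fun n => ?_
      simp only [φ]; linarith
  · intro p hp B B' hB hB' hBB n
    constructor
    · refine moll_est (φ n) (fun x => ‖u x‖ₑ) _ hu.aestronglyMeasurable.enorm hp hB hB' ?_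
        (fun x hx t ht => hBB x hx t (ht.trans_le (hrle n)))
      intro x
      beta_reduce
      rw [convolution_def]
      refine (enorm_integral_le_lintegral_enorm _).trans (le_of_eq ?_)
      refine lintegral_congr fun t => ?_
      simp [enorm_mul]
    · exact moll_est (φ n) (fun x => ‖gradNorm1 g x‖ₑ) _ hGm.enorm hp hB hB'
        (fun x => moll_fderiv (φ n) u g hN hg x)
        (fun x hx t ht => hBB x hx t (ht.trans_le (hrle n)))

/-- planar rotation, as a function -/
def rotFun {N : ℕ} (τ ν : Euc N) (s : ℝ) (x : Euc N) : Euc N :=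
  x + ((Real.cos s - 1) * inner ℝ τ x - Real.sin s * inner ℝ ν x) • τ
    + ((Real.cos s - 1) * inner ℝ ν x + Real.sin s * inner ℝ τ x) • ν

theorem norm_sq_comb {N : ℕ} (τ ν x : Euc N) (hτ : ‖τ‖ = 1) (hν : ‖ν‖ = 1)
    (h : inner ℝ τ ν = (0 : ℝ)) (α β : ℝ) :
    ‖x + α • τ + β • ν‖ ^ 2 = ‖x‖ ^ 2 + α ^ 2 + β ^ 2 + 2 * α * inner ℝ τ x
      + 2 * β * inner ℝ ν x := by
  rw [← real_inner_self_eq_norm_sq, ← real_inner_self_eq_norm_sq]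
  have h1 : inner ℝ τ τ = (1 : ℝ) := by rw [real_inner_self_eq_norm_sq, hτ]; norm_num
  have h2 : inner ℝ ν ν = (1 : ℝ) := by rw [real_inner_self_eq_norm_sq, hν]; norm_num
  have h3 : inner ℝ ν τ = (0 : ℝ) := by rw [real_inner_comm]; exact h
  have h4 : inner ℝ x τ = (inner ℝ τ x : ℝ) := real_inner_comm _ _
  have h5 : inner ℝ x ν = (inner ℝ ν x : ℝ) := real_inner_comm _ _
  simp only [inner_add_left, inner_add_right, inner_smul_left, inner_smul_right, h, h1, h2, h3,
    h4, h5, RCLike.conj_to_real]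
  ring

theorem rotFun_norm {N : ℕ} (τ ν : Euc N) (hτ : ‖τ‖ = 1) (hν : ‖ν‖ = 1)
    (h : inner ℝ τ ν = (0 : ℝ)) (s : ℝ) (x : Euc N) : ‖rotFun τ ν s x‖ = ‖x‖ := by
  have : ‖rotFun τ ν s x‖ ^ 2 = ‖x‖ ^ 2 := by
    rw [rotFun, norm_sq_comb τ ν x hτ hν h]
    have := Real.sin_sq_add_cos_sq s
    linear_combination ((inner ℝ τ x : ℝ) ^ 2 + (inner ℝ ν x : ℝ) ^ 2) * this
  exact (pow_left_inj₀ (norm_nonneg _) (norm_nonneg _) two_ne_zero).1 this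

def rotLin {N : ℕ} (τ ν : Euc N) (hτ : ‖τ‖ = 1) (hν : ‖ν‖ = 1)
    (h : inner ℝ τ ν = (0 : ℝ)) (s : ℝ) : Euc N →ₗᵢ[ℝ] Euc N where
  toFun := rotFun τ ν s
  map_add' x y := by
    simp only [rotFun, inner_add_right]; module
  map_smul' c x := by
    simp only [rotFun, inner_smul_right, RingHom.id_apply]; module
  norm_map' x := rotFun_norm τ ν hτ hν h s x

theorem rotFun_mp {N : ℕ} (τ ν : Euc N) (hτ : ‖τ‖ = 1) (hν : ‖ν‖ = 1)
    (h : inner ℝ τ ν = (0 : ℝ)) (s : ℝ) : MeasurePreserving (rotFun τ ν s) volume volume :=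
  ((rotLin τ ν hτ hν h s).toLinearIsometryEquiv rfl).measurePreserving

theorem rotFun_deriv {N : ℕ} (τ ν x : Euc N) (s : ℝ) :
    HasDerivAt (fun s => rotFun τ ν s x)
      ((-Real.sin s * inner ℝ τ x - Real.cos s * inner ℝ ν x) • τ
      + (-Real.sin s * inner ℝ ν x + Real.cos s * inner ℝ τ x) • ν) s := by
  unfold rotFun
  have hc := (Real.hasDerivAt_cos s).sub_const 1
  have hs := Real.hasDerivAt_sin s
  have h1 := ((hc.mul_const (inner ℝ τ x : ℝ)).sub (hs.mul_const (inner ℝ ν x : ℝ))).smul_const τ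
  have h2 := ((hc.mul_const (inner ℝ ν x : ℝ)).add (hs.mul_const (inner ℝ τ x : ℝ))).smul_const ν
  exact (h1.const_add x).add h2

theorem rotFun_deriv_norm {N : ℕ} (τ ν x : Euc N) (hτ : ‖τ‖ = 1) (hν : ‖ν‖ = 1)
    (h : inner ℝ τ ν = (0 : ℝ)) (s : ℝ) :
    ‖(-Real.sin s * inner ℝ τ x - Real.cos s * inner ℝ ν x) • τ
      + (-Real.sin s * inner ℝ ν x + Real.cos s * inner ℝ τ x) • ν‖ ≤ ‖x‖ := by
  have h1 := norm_sq_comb τ ν 0 hτ hν h (-Real.sin s * inner ℝ τ x - Real.cos s * inner ℝ ν x)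
    (-Real.sin s * inner ℝ ν x + Real.cos s * inner ℝ τ x)
  have h2 := norm_sq_comb τ ν x hτ hν h (-inner ℝ τ x) (-inner ℝ ν x)
  rw [zero_add] at h1
  refine (sq_le_sq₀ (norm_nonneg _) (norm_nonneg _)).1 ?_
  rw [h1]
  have h3 := Real.sin_sq_add_cos_sq s
  have h4 := sq_nonneg ‖x + -inner ℝ τ x • τ + -inner ℝ ν x • ν‖
  rw [h2] at h4
  simp only [norm_zero, inner_zero_right]
  have : ((inner ℝ τ x : ℝ) ^ 2 + (inner ℝ ν x : ℝ) ^ 2) * (Real.sin s ^ 2 + Real.cos s ^ 2)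
    = (inner ℝ τ x : ℝ) ^ 2 + (inner ℝ ν x : ℝ) ^ 2 := by rw [h3, mul_one]
  nlinarith

theorem refl_in_orbit {N : ℕ} (τ ν x : Euc N) : ∃ s ∈ Set.Icc (-Real.pi) (3 * Real.pi),
    rotFun τ ν s x = x - (2 * inner ℝ τ x : ℝ) • τ := by
  set z : ℂ := ⟨inner ℝ τ x, inner ℝ ν x⟩ with hz
  have h1 := Complex.norm_mul_cos_arg z
  have h2 := Complex.norm_mul_sin_arg z
  simp only [hz] at h1 h2
  rw [← hz] at h1 h2
  refine ⟨Real.pi - 2 * z.arg, ?_, ?_⟩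
  · have := Complex.neg_pi_lt_arg z
    have := Complex.arg_le_pi z
    constructor <;> linarith
  · rw [rotFun, Real.cos_pi_sub, Real.sin_pi_sub, Real.cos_two_mul, Real.sin_two_mul, ← h1, ← h2]
    have h3 := Real.sin_sq_add_cos_sq z.arg
    have e1 : (-(2 * Real.cos z.arg ^ 2 - 1) - 1) * (‖z‖ * Real.cos z.arg) -
        2 * Real.sin z.arg * Real.cos z.arg * (‖z‖ * Real.sin z.arg)
        = - (2 * (‖z‖ * Real.cos z.arg)) := by
      linear_combination (-2 * ‖z‖ * Real.cos z.arg) * h3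
    have e2 : (-(2 * Real.cos z.arg ^ 2 - 1) - 1) * (‖z‖ * Real.sin z.arg) +
        2 * Real.sin z.arg * Real.cos z.arg * (‖z‖ * Real.cos z.arg) = 0 := by
      ring
    rw [e1, e2]; module

theorem exists_orthonormal_pair {N : ℕ} (hN : 1 < N) (τ : Euc N) :
    ∃ ν : Euc N, ‖ν‖ = 1 ∧ inner ℝ τ ν = (0 : ℝ) := by
  have : (ℝ ∙ τ)ᗮ ≠ ⊥ := by
    intro h
    rw [Submodule.orthogonal_eq_bot_iff] at h
    have h1 := finrank_span_le_card (R := ℝ) ({τ} : Set (Euc N))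
    rw [h] at h1
    simp at h1
    omega
  obtain ⟨v, hv, hv0⟩ := Submodule.exists_mem_ne_zero_of_ne_bot this
  refine ⟨‖v‖⁻¹ • v, ?_, ?_⟩
  · simp [norm_smul, hv0]
  · rw [inner_smul_right, Submodule.mem_orthogonal_singleton_iff_inner_right.1 hv, mul_zero]

def RadSet {N : ℕ} (B : Set (Euc N)) : Prop := ∀ x y : Euc N, ‖x‖ = ‖y‖ → (x ∈ B ↔ y ∈ B)

theorem refl_pointwise {N : ℕ} (τ ν : Euc N) (hτ : ‖τ‖ = 1) (hν : ‖ν‖ = 1)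
    (h : inner ℝ τ ν = (0 : ℝ)) (w : Euc N → ℝ) (hw : ContDiff ℝ 1 w) (x : Euc N) :
    ‖w x - w (x - (2 * inner ℝ τ x : ℝ) • τ)‖ₑ ≤
      ∫⁻ s in Set.Icc (-Real.pi) (3 * Real.pi), ‖fderiv ℝ w (rotFun τ ν s x)‖ₑ * ‖x‖ₑ := by
  obtain ⟨s₀, hs₀, hs₁⟩ := refl_in_orbit τ ν x
  rw [← hs₁]
  set d : ℝ → Euc N := fun s => (-Real.sin s * inner ℝ τ x - Real.cos s * inner ℝ ν x) • τ
      + (-Real.sin s * inner ℝ ν x + Real.cos s * inner ℝ τ x) • ν with hd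
  have hder : ∀ s, HasDerivAt (fun s => w (rotFun τ ν s x)) (fderiv ℝ w (rotFun τ ν s x) (d s)) s :=
    fun s => ((hw.differentiable (by simp)) _).hasFDerivAt.comp_hasDerivAt s (rotFun_deriv τ ν x s)
  have hrc : Continuous (fun s => rotFun τ ν s x) := by unfold rotFun; fun_prop
  have hc : Continuous (fun s => fderiv ℝ w (rotFun τ ν s x) (d s)) := by
    refine ((hw.continuous_fderiv (by simp)).comp hrc).clm_apply ?_
    simp only [hd]; fun_prop
  have hF := intervalIntegral.integral_eq_sub_of_hasDerivAt (a := 0) (b := s₀)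
    (fun s _ => hder s) (hc.intervalIntegrable _ _)
  have h0 : rotFun τ ν 0 x = x := by simp [rotFun]
  simp only [h0] at hF
  rw [enorm_sub_rev, ← hF, ← ofReal_norm, intervalIntegral.norm_integral_eq_norm_integral_uIoc,
    ofReal_norm]
  refine (enorm_integral_le_lintegral_enorm _).trans ?_
  have hsub : Set.uIoc 0 s₀ ⊆ Set.Icc (-Real.pi) (3 * Real.pi) := by
    refine Set.uIoc_subset_uIcc.trans (Set.uIcc_subset_Icc ?_ hs₀)
    constructor <;> linarith [Real.pi_pos]
  refine (lintegral_mono_set hsub).trans (lintegral_mono fun s => ?_)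
  refine ((fderiv ℝ w (rotFun τ ν s x)).le_opENorm (d s)).trans ?_
  refine mul_le_mul_right ?_ _
  rw [← ofReal_norm, ← ofReal_norm]
  exact ENNReal.ofReal_le_ofReal (rotFun_deriv_norm τ ν x hτ hν h s)

theorem refl_formula {N : ℕ} (v : Euc N) (hv : v ≠ 0) (x : Euc N) :
    (ℝ ∙ v)ᗮ.reflection x = x - (2 * inner ℝ (‖v‖⁻¹ • v) x : ℝ) • (‖v‖⁻¹ • v) := by
  rw [Submodule.reflection_orthogonal_apply, Submodule.reflection_singleton_apply]
  have : ‖v‖ ≠ 0 := norm_ne_zero_iff.2 hv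
  simp only [inner_smul_left, smul_smul, RCLike.ofReal_real_eq_id, id, RCLike.conj_to_real]
  rw [neg_sub, two_smul, ← add_smul]
  congr 2
  field_simp
  ring

theorem refl_smooth {N : ℕ} (hN : 1 < N) (v : Euc N) (w : Euc N → ℝ) (hw : ContDiff ℝ 1 w)
    {p : ℝ} (hp : 1 ≤ p) (B : Set (Euc N)) (hB : MeasurableSet B) (hBr : RadSet B) (R : ℝ)
    (hR : ∀ x ∈ B, ‖x‖ ≤ R) :
    ∫⁻ x in B, ‖w x - w ((ℝ ∙ v)ᗮ.reflection x)‖ₑ ^ p ≤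
      ENNReal.ofReal (4 * Real.pi * R) ^ p * ∫⁻ x in B, ‖fderiv ℝ w x‖ₑ ^ p := by
  by_cases hv : v = 0
  · subst hv
    have : ∀ x : Euc N, (ℝ ∙ (0 : Euc N))ᗮ.reflection x = x := by
      intro x
      refine Submodule.reflection_mem_subspace_eq_self ?_
      simp
    simp only [this, sub_self, enorm_zero, ENNReal.zero_rpow_of_pos (show 0 < p by linarith)]
    simp
  obtain ⟨ν, hν, hτν⟩ := exists_orthonormal_pair hN (‖v‖⁻¹ • v)
  have hτ : ‖‖v‖⁻¹ • v‖ = 1 := by simp [norm_smul, hv]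
  set τ := ‖v‖⁻¹ • v with hτd
  have hp0 : 0 ≤ p := by linarith
  have hfc : Continuous (fderiv ℝ w) := hw.continuous_fderiv (by simp)
  have hrc : Continuous (fun z : Euc N × ℝ => rotFun τ ν z.2 z.1) := by unfold rotFun; fun_prop
  set I := Set.Icc (-Real.pi) (3 * Real.pi) with hI
  have hvol : (volume : Measure ℝ) I = ENNReal.ofReal (4 * Real.pi) := by
    rw [hI, Real.volume_Icc]; congr 1; ring
  have key : ∀ x ∈ B, ‖w x - w ((ℝ ∙ v)ᗮ.reflection x)‖ₑ ^ p ≤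
      ENNReal.ofReal (4 * Real.pi) ^ (p - 1) * ENNReal.ofReal R ^ p *
        ∫⁻ s in I, ‖fderiv ℝ w (rotFun τ ν s x)‖ₑ ^ p := by
    intro x hx
    rw [refl_formula v hv x]
    refine (ENNReal.rpow_le_rpow (refl_pointwise τ ν hτ hν hτν w hw x) hp0).trans ?_
    have hcx : Continuous (fun s => ‖fderiv ℝ w (rotFun τ ν s x)‖ₑ) :=
      (hfc.comp (hrc.comp (continuous_const.prodMk continuous_id))).enorm
    rw [lintegral_mul_const _ hcx.measurable, ENNReal.mul_rpow_of_nonneg _ _ hp0]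
    have h1 := jensen_pow (volume.restrict I) (fun s => ‖fderiv ℝ w (rotFun τ ν s x)‖ₑ)
      hcx.measurable.aemeasurable hp
    rw [Measure.restrict_apply_univ, hvol] at h1
    have h2 : ‖x‖ₑ ^ p ≤ ENNReal.ofReal R ^ p := by
      refine ENNReal.rpow_le_rpow ?_ hp0
      rw [← ofReal_norm]; exact ENNReal.ofReal_le_ofReal (hR x hx)
    calc _ ≤ (ENNReal.ofReal (4 * Real.pi) ^ (p - 1) * ∫⁻ s in I, ‖fderiv ℝ w (rotFun τ ν s x)‖ₑ ^ p)
          * ENNReal.ofReal R ^ p := mul_le_mul' h1 h2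
      _ = _ := by ring
  have hms : Measurable (fun z : Euc N × ℝ => ‖fderiv ℝ w (rotFun τ ν z.2 z.1)‖ₑ ^ p) :=
    ((hfc.comp hrc).enorm.measurable).pow_const p
  calc ∫⁻ x in B, ‖w x - w ((ℝ ∙ v)ᗮ.reflection x)‖ₑ ^ p
      ≤ ∫⁻ x in B, ENNReal.ofReal (4 * Real.pi) ^ (p - 1) * ENNReal.ofReal R ^ p *
        ∫⁻ s in I, ‖fderiv ℝ w (rotFun τ ν s x)‖ₑ ^ p := setLIntegral_mono' hB key
    _ = ENNReal.ofReal (4 * Real.pi) ^ (p - 1) * ENNReal.ofReal R ^ p *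
        ∫⁻ x in B, ∫⁻ s in I, ‖fderiv ℝ w (rotFun τ ν s x)‖ₑ ^ p := by
        rw [lintegral_const_mul _ (Measurable.lintegral_prod_right hms)]
    _ = ENNReal.ofReal (4 * Real.pi) ^ (p - 1) * ENNReal.ofReal R ^ p *
        ∫⁻ s in I, ∫⁻ x in B, ‖fderiv ℝ w (rotFun τ ν s x)‖ₑ ^ p := by
        rw [lintegral_lintegral_swap hms.aemeasurable]
    _ = ENNReal.ofReal (4 * Real.pi) ^ (p - 1) * ENNReal.ofReal R ^ p *
        ∫⁻ s in I, ∫⁻ x in B, ‖fderiv ℝ w x‖ₑ ^ p := by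
        congr 1
        refine lintegral_congr fun s => ?_
        have hmp := rotFun_mp τ ν hτ hν hτν s
        have hpre : rotFun τ ν s ⁻¹' B = B := by
          ext x; exact hBr _ _ (rotFun_norm τ ν hτ hν hτν s x)
        have := hmp.setLIntegral_comp_preimage hB (f := fun x => ‖fderiv ℝ w x‖ₑ ^ p)
          (hfc.enorm.measurable.pow_const p)
        rw [hpre] at this
        exact this
    _ = ENNReal.ofReal (4 * Real.pi * R) ^ p * ∫⁻ x in B, ‖fderiv ℝ w x‖ₑ ^ p := by
        rw [lintegral_const, Measure.restrict_apply_univ, hvol,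
          ENNReal.ofReal_mul (p := 4 * Real.pi) (by positivity), ENNReal.mul_rpow_of_nonneg _ _ hp0]
        have : ENNReal.ofReal (4 * Real.pi) ^ p
            = ENNReal.ofReal (4 * Real.pi) ^ (p - 1) * ENNReal.ofReal (4 * Real.pi) := by
          conv_rhs => rw [← ENNReal.rpow_one (ENNReal.ofReal (4 * Real.pi)), ← ENNReal.rpow_mul,
            one_mul]
          rw [← ENNReal.rpow_add _ _ (by simp [Real.pi_pos]) ENNReal.ofReal_ne_top]
          simp
        rw [this]; ring

theorem refl_weak {N : ℕ} (hN : 1 < N) (v : Euc N) (u : Euc N → ℝ) (g : Fin N → Euc N → ℝ)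
    (hg : ∀ i, IsWeakPartialDeriv i u (g i)) (δ : ℝ) (hδ : 0 < δ)
    {p : ℝ} (hp : 1 ≤ p) (B B' : Set (Euc N)) (hB : MeasurableSet B) (hB' : MeasurableSet B')
    (hBr : RadSet B) (R : ℝ) (hR : ∀ x ∈ B, ‖x‖ ≤ R)
    (hBB : ∀ x ∈ B, ∀ t : Euc N, ‖t‖ < δ → x - t ∈ B') :
    ∫⁻ x in B, ‖u x - u ((ℝ ∙ v)ᗮ.reflection x)‖ₑ ^ p ≤
      ENNReal.ofReal (4 * Real.pi * R) ^ p * ∫⁻ x in B', ‖gradNorm1 g x‖ₑ ^ p := by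
  obtain ⟨w, hw, hlim, hest⟩ := moll_seq (by omega) u g hg δ hδ
  have hmp : MeasurePreserving ((ℝ ∙ v)ᗮ.reflection) (volume : Measure (Euc N)) volume :=
    LinearIsometryEquiv.measurePreserving _
  have hlim2 : ∀ᵐ x, Tendsto (fun n => w n ((ℝ ∙ v)ᗮ.reflection x)) atTop
      (𝓝 (u ((ℝ ∙ v)ᗮ.reflection x))) := hmp.quasiMeasurePreserving.ae hlim
  have hp0 : 0 ≤ p := by linarith
  have h1 : ∫⁻ x in B, ‖u x - u ((ℝ ∙ v)ᗮ.reflection x)‖ₑ ^ p ≤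
      ∫⁻ x in B, liminf (fun n => ‖w n x - w n ((ℝ ∙ v)ᗮ.reflection x)‖ₑ ^ p) atTop := by
    refine lintegral_mono_ae (ae_restrict_of_ae ?_)
    filter_upwards [hlim, hlim2] with x h1 h2
    refine le_of_eq (Tendsto.liminf_eq ?_).symm
    exact ((ENNReal.continuous_rpow_const.tendsto _).comp
      ((continuous_enorm.tendsto _).comp (h1.sub h2)))
  refine h1.trans ((lintegral_liminf_le ?_).trans ?_)
  · intro n
    have : Continuous (fun x => w n x - w n ((ℝ ∙ v)ᗮ.reflection x)) :=
      (hw n).continuous.sub ((hw n).continuous.comp (LinearIsometryEquiv.continuous _))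
    exact this.enorm.measurable.pow_const p
  · refine liminf_le_of_le (by isBoundedDefault) fun b hb => ?_
    obtain ⟨n, hn⟩ := hb.exists
    refine hn.trans ((refl_smooth hN v (w n) (hw n) hp B hB hBr R hR).trans ?_)
    exact mul_le_mul_right (hest p hp B B' hB hB' hBB n).2 _

theorem eLpNorm_ofReal_eq {α : Type*} {F : Type*} [NormedAddCommGroup F] [MeasurableSpace α]
    (μ : Measure α) (f : α → F) {p : ℝ} (hp : 1 ≤ p) :
    eLpNorm f (ENNReal.ofReal p) μ = (∫⁻ x, ‖f x‖ₑ ^ p ∂μ) ^ (1 / p) := by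
  rw [eLpNorm_eq_lintegral_rpow_enorm_toReal (by simp; linarith) (by simp),
    ENNReal.toReal_ofReal (by linarith)]

theorem mp_restrict_rad {N : ℕ} (T : Euc N ≃ₗᵢ[ℝ] Euc N) (B : Set (Euc N)) (hB : MeasurableSet B)
    (hBr : RadSet B) : MeasurePreserving T (volume.restrict B) (volume.restrict B) := by
  have h := T.measurePreserving.restrict_preimage hB
  have : T ⁻¹' B = B := by ext x; exact hBr _ _ (T.norm_map x)
  rwa [this] at h

theorem list_weak {N : ℕ} (u : Euc N → ℝ) (hu : AEStronglyMeasurable u volume)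
    {p : ℝ} (hp : 1 ≤ p) (B : Set (Euc N)) (hB : MeasurableSet B)
    (hBr : RadSet B) (K : ℝ≥0∞)
    (hK : ∀ v : Euc N, eLpNorm (fun x => u x - u ((ℝ ∙ v)ᗮ.reflection x)) (ENNReal.ofReal p)
      (volume.restrict B) ≤ K) (l : List (Euc N)) :
    eLpNorm (fun x => u x - u ((l.map fun v => (ℝ ∙ v)ᗮ.reflection).prod x)) (ENNReal.ofReal p)
      (volume.restrict B) ≤ l.length * K := by
  induction l with
  | nil => simp
  | cons v l ih =>
    set T := (l.map fun v => (ℝ ∙ v)ᗮ.reflection).prod with hT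
    have hum : ∀ S : Euc N ≃ₗᵢ[ℝ] Euc N, AEStronglyMeasurable (fun x => u (S x)) volume :=
      fun S => hu.comp_quasiMeasurePreserving S.measurePreserving.quasiMeasurePreserving
    have e1 : (fun x => u x - u (((v :: l).map fun v => (ℝ ∙ v)ᗮ.reflection).prod x))
        = (fun x => u x - u (T x)) +
          (fun x => u x - u ((ℝ ∙ v)ᗮ.reflection x)) ∘ T := by
      funext x
      simp [hT]
    rw [e1]
    refine (eLpNorm_add_le (hu.sub (hum T)).restrict
      ((hu.sub (hum _)).restrict.comp_measurePreserving (mp_restrict_rad T B hB hBr)) (by simpa)).trans ?_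
    rw [eLpNorm_comp_measurePreserving (hu.sub (hum _)).restrict (mp_restrict_rad T B hB hBr)]
    refine (add_le_add ih (hK v)).trans (le_of_eq ?_)
    simp only [List.length_cons]; push_cast; ring

theorem iso_weak {N : ℕ} (hN : 1 < N) (T : Euc N ≃ₗᵢ[ℝ] Euc N) (u : Euc N → ℝ)
    (g : Fin N → Euc N → ℝ)
    (hg : ∀ i, IsWeakPartialDeriv i u (g i)) (δ : ℝ) (hδ : 0 < δ)
    {p : ℝ} (hp : 1 ≤ p) (B B' : Set (Euc N)) (hB : MeasurableSet B) (hB' : MeasurableSet B')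
    (hBr : RadSet B) (R : ℝ) (hR : ∀ x ∈ B, ‖x‖ ≤ R)
    (hBB : ∀ x ∈ B, ∀ t : Euc N, ‖t‖ < δ → x - t ∈ B') :
    ∫⁻ x in B, ‖u x - u (T x)‖ₑ ^ p ≤
      (N * ENNReal.ofReal (4 * Real.pi * R)) ^ p * ∫⁻ x in B', ‖gradNorm1 g x‖ₑ ^ p := by
  have hu : AEStronglyMeasurable u volume := (hg ⟨0, by omega⟩).1.aestronglyMeasurable
  obtain ⟨l, hl, rfl⟩ := T.reflections_generate_dim
  have hp0 : 0 < p := by linarith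
  have h := list_weak u hu hp B hB hBr
    (ENNReal.ofReal (4 * Real.pi * R) * (∫⁻ x in B', ‖gradNorm1 g x‖ₑ ^ p) ^ (1 / p)) (fun v => by
      rw [eLpNorm_ofReal_eq _ _ hp, one_div, ENNReal.rpow_inv_le_iff hp0,
        ENNReal.mul_rpow_of_nonneg _ _ hp0.le, ← ENNReal.rpow_mul, inv_mul_cancel₀ hp0.ne',
        ENNReal.rpow_one]
      exact refl_weak hN v u g hg δ hδ hp B B' hB hB' hBr R hR hBB) l
  rw [eLpNorm_ofReal_eq _ _ hp, one_div, ENNReal.rpow_inv_le_iff hp0,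
        ENNReal.mul_rpow_of_nonneg _ _ hp0.le, ENNReal.mul_rpow_of_nonneg _ _ hp0.le,
        ← ENNReal.rpow_mul, inv_mul_cancel₀ hp0.ne',
        ENNReal.rpow_one] at h
  refine h.trans ?_
  rw [ENNReal.mul_rpow_of_nonneg _ _ hp0.le, mul_assoc ((N : ℝ≥0∞) ^ p)]
  refine mul_le_mul_left (ENNReal.rpow_le_rpow ?_ hp0.le) _
  have : l.length ≤ N := by simpa using hl
  exact_mod_cast this

/-! ### Haar averaging -/


theorem unitary_compact (H : Type) [NormedAddCommGroup H] [InnerProductSpace ℝ H]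
    [FiniteDimensional ℝ H] [CompleteSpace H] : CompactSpace (unitary (H →L[ℝ] H)) := by
  suffices h : IsCompact (unitary (H →L[ℝ] H) : Set (H →L[ℝ] H)) from
    isCompact_iff_compactSpace.1 h
  have : ProperSpace (H →L[ℝ] H) := FiniteDimensional.proper ℝ _
  refine Metric.isCompact_of_isClosed_isBounded isClosed_unitary ?_
  refine (Metric.isBounded_closedBall (x := (0 : H →L[ℝ] H)) (r := 1)).subset ?_
  intro T hT
  simp only [mem_closedBall, dist_zero_right]
  refine ContinuousLinearMap.opNorm_le_bound _ zero_le_one fun x => ?_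
  rw [ContinuousLinearMap.norm_map_of_mem_unitary hT, one_mul]

/-- Averaging over the orthogonal group. -/
theorem haar_exists (H : Type) [NormedAddCommGroup H] [InnerProductSpace ℝ H]
    [FiniteDimensional ℝ H] [CompleteSpace H] [MeasurableSpace H] [BorelSpace H] :
    ∃ (G : Type) (_ : MeasurableSpace G) (μ : Measure G) (act : G → H ≃ₗᵢ[ℝ] H),
      IsProbabilityMeasure μ ∧ Measurable (fun z : G × H => act z.1 z.2) ∧
      ∀ x y : H, ‖x‖ = ‖y‖ → Measure.map (fun R => act R x) μ = Measure.map (fun R => act R y) μ := by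
  have : ProperSpace (H →L[ℝ] H) := FiniteDimensional.proper ℝ _
  have : ProperSpace H := FiniteDimensional.proper ℝ _
  have := unitary_compact H
  let K : TopologicalSpace.PositiveCompacts (unitary (H →L[ℝ] H)) := ⊤
  have hcont : Continuous (fun z : unitary (H →L[ℝ] H) × H =>
      ((z.1⁻¹ : unitary (H →L[ℝ] H)) : H →L[ℝ] H) z.2) :=
    (continuous_subtype_val.comp (continuous_inv.comp continuous_fst)).clm_apply continuous_snd
  refine ⟨unitary (H →L[ℝ] H), inferInstance, Measure.haarMeasure K,
    fun R => Unitary.linearIsometryEquiv R⁻¹, ⟨?_⟩, ?_, ?_⟩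
  · exact Measure.haarMeasure_self (K₀ := K)
  · exact hcont.measurable
  · intro x y hxy
    obtain ⟨T, hT⟩ : ∃ T : unitary (H →L[ℝ] H), (T : H →L[ℝ] H) x = y := by
      refine ⟨Unitary.linearIsometryEquiv.symm ((ℝ ∙ (x - y))ᗮ.reflection), ?_⟩
      have := Submodule.reflection_sub hxy
      simpa using this
    have hm : ∀ z : H, Measurable (fun R : unitary (H →L[ℝ] H) =>
        Unitary.linearIsometryEquiv R⁻¹ z) := fun z =>
      (hcont.comp (continuous_id.prodMk continuous_const)).measurable
    have e : (fun R : unitary (H →L[ℝ] H) => Unitary.linearIsometryEquiv R⁻¹ y)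
        = (fun R : unitary (H →L[ℝ] H) => Unitary.linearIsometryEquiv R⁻¹ x) ∘ (fun R => T⁻¹ * R) := by
      funext R
      simp only [Function.comp, mul_inv_rev, inv_inv, ← hT]
      simp; rfl
    rw [e, ← Measure.map_map (hm x) (measurable_const_mul _), map_mul_left_eq_self]

open scoped Pointwise in
theorem sphere_mp {N : ℕ} (T : Euc N ≃ₗᵢ[ℝ] Euc N) :
    MeasurePreserving (fun σ : sphere (0 : Euc N) 1 =>
      (⟨T σ, by simp⟩ : sphere (0 : Euc N) 1)) (volume : Measure (Euc N)).toSphere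
      (volume : Measure (Euc N)).toSphere := by
  have hm : Measurable (fun σ : sphere (0 : Euc N) 1 =>
      (⟨T σ, by simp⟩ : sphere (0 : Euc N) 1)) :=
    (T.continuous.comp continuous_subtype_val).measurable.subtype_mk
  refine ⟨hm, ?_⟩
  ext s hs
  rw [Measure.map_apply hm hs, Measure.toSphere_apply' _ hs, Measure.toSphere_apply' _ (hm hs)]
  congr 1
  rw [← T.measurePreserving.measure_preimage_emb T.toHomeomorph.measurableEmbedding
    (Set.Ioo (0 : ℝ) 1 • (Subtype.val '' s))]
  congr 1
  ext x
  simp only [Set.mem_smul, Set.mem_preimage, Set.mem_image]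
  constructor
  · rintro ⟨r, hr, y, ⟨σ, hσ, rfl⟩, rfl⟩
    exact ⟨r, hr, T σ, ⟨_, hσ, rfl⟩, by simp⟩
  · rintro ⟨r, hr, y, ⟨σ, hσ, rfl⟩, h⟩
    refine ⟨r, hr, T.symm σ, ⟨⟨T.symm σ, by simp⟩, by simpa using hσ, rfl⟩, ?_⟩
    apply T.injective
    simp [h]

theorem polar_lintegral_s10 {N : ℕ} (hN : 0 < N) (F : Euc N → ℝ≥0∞) (hF : Measurable F) :
    ∫⁻ x, F x = ∫⁻ r : Set.Ioi (0 : ℝ), ∫⁻ σ : sphere (0 : Euc N) 1, F ((r : ℝ) • (σ : Euc N))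
      ∂(volume : Measure (Euc N)).toSphere ∂(Measure.volumeIoiPow (N - 1)) := by
  have : Nonempty (Fin N) := ⟨⟨0, hN⟩⟩
  have h1 : ∫⁻ x, F x = ∫⁻ x : ({0}ᶜ : Set (Euc N)), F x.1
      ∂((volume : Measure (Euc N)).comap Subtype.val) := by
    rw [lintegral_subtype_comap (measurableSet_singleton (0 : Euc N)).compl,
      restrict_compl_singleton]
  have hmp := (volume : Measure (Euc N)).measurePreserving_homeomorphUnitSphereProd
  have hm : Measurable (fun z : sphere (0 : Euc N) 1 × Set.Ioi (0 : ℝ) =>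
      F ((z.2 : ℝ) • (z.1 : Euc N))) := hF.comp (by fun_prop)
  have h2 := hmp.lintegral_comp hm
  rw [h1]
  have e : ∀ x : ({0}ᶜ : Set (Euc N)), F (((homeomorphUnitSphereProd (Euc N) x).2 : ℝ) •
      ((homeomorphUnitSphereProd (Euc N) x).1 : Euc N)) = F x := by
    intro x
    congr 1
    simp only [homeomorphUnitSphereProd_apply_snd_coe, homeomorphUnitSphereProd_apply_fst_coe]
    rw [smul_smul, mul_inv_cancel₀ (norm_ne_zero_iff.2 x.2), one_smul]
  simp only [e] at h2
  rw [h2, lintegral_prod_symm' _ hm]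
  simp

theorem ae_of_ae_radius {N : ℕ} (hN : 0 < N) (P : ℝ → Prop)
    (h : ∀ᵐ r : Set.Ioi (0 : ℝ) ∂(Measure.volumeIoiPow (N - 1)), P r) :
    ∀ᵐ x : Euc N, P ‖x‖ := by
  have : Nonempty (Fin N) := ⟨⟨0, hN⟩⟩
  obtain ⟨Z, hZ, hZm, hZ0⟩ := exists_measurable_superset_of_null (ae_iff.1 h)
  have hZ2 : MeasurableSet ((↑) '' Z : Set ℝ) := measurableSet_Ioi.subtype_image hZm
  have hF : Measurable (fun x : Euc N => ((↑) '' Z : Set ℝ).indicator (fun _ => (1 : ℝ≥0∞)) ‖x‖) :=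
    (measurable_const.indicator hZ2).comp measurable_norm
  have h1 := polar_lintegral_s10 hN _ hF
  have h2 : ∫⁻ x : Euc N, ((↑) '' Z : Set ℝ).indicator (fun _ => (1 : ℝ≥0∞)) ‖x‖ = 0 := by
    rw [h1]
    rw [lintegral_congr_ae (g := fun _ => 0) ?_]
    · simp
    have : ∀ᵐ r ∂(Measure.volumeIoiPow (N - 1)), r ∉ Z := by
      rw [ae_iff]; simpa using hZ0
    filter_upwards [this] with r hr
    rw [lintegral_congr (g := fun _ => 0) ?_]
    · simp
    intro σ
    have : ‖(r : ℝ) • (σ : Euc N)‖ = r := by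
      rw [norm_smul]; simp [abs_of_pos (show 0 < (r : ℝ) from r.2)]
    rw [this]
    simp [hr]
  rw [lintegral_eq_zero_iff hF] at h2
  filter_upwards [h2, Measure.ae_ne volume (0 : Euc N)] with x hx hx0
  by_contra hP
  have hmem : (⟨‖x‖, norm_pos_iff.2 hx0⟩ : Set.Ioi (0 : ℝ)) ∈ Z := hZ hP
  have : ‖x‖ ∈ ((↑) '' Z : Set ℝ) := ⟨_, hmem, rfl⟩
  simp only [Pi.zero_apply, Set.indicator_of_mem this] at hx
  exact one_ne_zero hx

theorem good_radii {N : ℕ} (hN : 0 < N) (u u' : Euc N → ℝ) (hu : LocallyIntegrable u volume)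
    (hu' : StronglyMeasurable u') (huu : u =ᵐ[volume] u') :
    ∀ᵐ x : Euc N, (∀ᵐ σ : sphere (0 : Euc N) 1 ∂(volume : Measure (Euc N)).toSphere,
        u (‖x‖ • (σ : Euc N)) = u' (‖x‖ • (σ : Euc N))) ∧
      ∫⁻ σ : sphere (0 : Euc N) 1, ‖u' (‖x‖ • (σ : Euc N))‖ₑ
        ∂(volume : Measure (Euc N)).toSphere < ⊤ := by
  refine ae_of_ae_radius hN (fun r => (∀ᵐ σ : sphere (0 : Euc N) 1 ∂(volume : Measure (Euc N)).toSphere,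
        u (r • (σ : Euc N)) = u' (r • (σ : Euc N))) ∧
      ∫⁻ σ : sphere (0 : Euc N) 1, ‖u' (r • (σ : Euc N))‖ₑ
        ∂(volume : Measure (Euc N)).toSphere < ⊤) ?_
  refine Filter.Eventually.and ?_ ?_
  · obtain ⟨Z, hZ, hZm, hZ0⟩ := exists_measurable_superset_of_null (ae_iff.1 huu)
    have hF : Measurable (Z.indicator (fun _ : Euc N => (1 : ℝ≥0∞))) :=
      measurable_const.indicator hZm
    have h1 := polar_lintegral_s10 hN _ hF
    rw [lintegral_indicator hZm] at h1
    simp only [lintegral_const, MeasurableSet.univ, Measure.restrict_apply, Set.univ_inter, hZ0,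
      mul_zero] at h1
    have hm : Measurable (fun z : Set.Ioi (0 : ℝ) × sphere (0 : Euc N) 1 =>
      Z.indicator (fun _ : Euc N => (1 : ℝ≥0∞)) ((z.1 : ℝ) • (z.2 : Euc N))) := hF.comp (by fun_prop)
    have h2 := (lintegral_eq_zero_iff hm.lintegral_prod_right').1 h1.symm
    filter_upwards [h2] with r hr
    have h3 := (lintegral_eq_zero_iff (hm.comp measurable_prodMk_left)).1 hr
    filter_upwards [h3] with σ hσ
    by_contra hne
    have hmem : (r : ℝ) • (σ : Euc N) ∈ Z := hZ hne
    simp [Function.comp, Set.indicator_of_mem hmem] at hσ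
  · have key : ∀ n : ℕ, ∀ᵐ r : Set.Ioi (0 : ℝ) ∂(Measure.volumeIoiPow (N - 1)), (r : ℝ) < n →
        ∫⁻ σ : sphere (0 : Euc N) 1, ‖u' ((r : ℝ) • (σ : Euc N))‖ₑ
        ∂(volume : Measure (Euc N)).toSphere < ⊤ := by
      intro n
      have hF : Measurable ((ball (0 : Euc N) n).indicator (fun x : Euc N => ‖u' x‖ₑ)) :=
        hu'.measurable.enorm.indicator measurableSet_ball
      have h1 := polar_lintegral_s10 hN _ hF
      have hfin : ∫⁻ x, (ball (0 : Euc N) n).indicator (fun x : Euc N => ‖u' x‖ₑ) x < ⊤ := by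
        rw [lintegral_indicator measurableSet_ball]
        rw [lintegral_congr_ae (g := fun x => ‖u x‖ₑ)
          (ae_restrict_of_ae (huu.mono fun x hx => by simp [hx]))]
        have := (hu.integrableOn_isCompact (isCompact_closedBall (0 : Euc N) n))
        exact (this.mono_set ball_subset_closedBall).2
      rw [h1] at hfin
      have hm : Measurable (fun z : Set.Ioi (0 : ℝ) × sphere (0 : Euc N) 1 =>
        (ball (0 : Euc N) n).indicator (fun x : Euc N => ‖u' x‖ₑ) ((z.1 : ℝ) • (z.2 : Euc N))) :=
        hF.comp (by fun_prop)
      filter_upwards [ae_lt_top hm.lintegral_prod_right' hfin.ne] with r hr hrn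
      refine lt_of_le_of_lt (lintegral_mono fun σ => ?_) hr
      have : (r : ℝ) • (σ : Euc N) ∈ ball (0 : Euc N) n := by
        simp [norm_smul, abs_of_pos (show 0 < (r : ℝ) from r.2), hrn]
      simp only [Set.indicator_of_mem this]; exact le_rfl
    filter_upwards [ae_all_iff.2 key] with r hr
    obtain ⟨n, hn⟩ := exists_nat_gt (r : ℝ)
    exact hr n hn

theorem avg_bound {N : ℕ} (hN : 0 < N) (u' : Euc N → ℝ) (hu' : StronglyMeasurable u')
    {G : Type} [MeasurableSpace G] (μ : Measure G) [IsProbabilityMeasure μ]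
    (act : G → Euc N ≃ₗᵢ[ℝ] Euc N) (hact : Measurable (fun z : G × Euc N => act z.1 z.2))
    (hlaw : ∀ x y : Euc N, ‖x‖ = ‖y‖ →
      Measure.map (fun R => act R x) μ = Measure.map (fun R => act R y) μ)
    (x : Euc N)
    (h1 : ∫⁻ σ : sphere (0 : Euc N) 1, ‖u' (‖x‖ • (σ : Euc N))‖ₑ
        ∂(volume : Measure (Euc N)).toSphere < ⊤)
    (h0 : ∫ σ : sphere (0 : Euc N) 1, u' (‖x‖ • (σ : Euc N))
        ∂(volume : Measure (Euc N)).toSphere = 0) :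
    ‖u' x‖ₑ ≤ ∫⁻ R, ‖u' x - u' (act R x)‖ₑ ∂μ := by
  have : Nonempty (Fin N) := ⟨⟨0, hN⟩⟩
  set τ := (volume : Measure (Euc N)).toSphere with hτ
  have hτ0 : τ ≠ 0 := by
    rw [hτ]; exact Measure.toSphere_ne_zero _
  have hm1 : ∀ y : Euc N, Measurable (fun R => act R y) := fun y =>
    hact.comp (measurable_id.prodMk measurable_const)
  have hn : ∀ σ : sphere (0 : Euc N) 1, ‖‖x‖ • (σ : Euc N)‖ = ‖x‖ := by
    intro σ; simp [norm_smul]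
  have hmm : Measurable (fun z : sphere (0 : Euc N) 1 × G => act z.2 (‖x‖ • (z.1 : Euc N))) :=
    hact.comp (measurable_snd.prodMk (by fun_prop))
  have hlaw1 : ∀ σ : sphere (0 : Euc N) 1, ∫⁻ R, ‖u' (act R (‖x‖ • (σ : Euc N)))‖ₑ ∂μ
      = ∫⁻ R, ‖u' (act R x)‖ₑ ∂μ := by
    intro σ
    rw [← lintegral_map (f := fun y => ‖u' y‖ₑ) hu'.measurable.enorm (hm1 _),
      ← lintegral_map (f := fun y => ‖u' y‖ₑ) hu'.measurable.enorm (hm1 _), hlaw _ _ (hn σ)]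
  have hlaw2 : ∀ σ : sphere (0 : Euc N) 1, ∫ R, u' (act R (‖x‖ • (σ : Euc N))) ∂μ
      = ∫ R, u' (act R x) ∂μ := by
    intro σ
    rw [← integral_map (f := fun y => u' y) (hm1 _).aemeasurable hu'.aestronglyMeasurable,
      ← integral_map (f := fun y => u' y) (hm1 _).aemeasurable hu'.aestronglyMeasurable,
      hlaw _ _ (hn σ)]
  have hum : StronglyMeasurable (fun z : sphere (0 : Euc N) 1 × G =>
      u' (act z.2 (‖x‖ • (z.1 : Euc N)))) := hu'.comp_measurable hmm
  have hsm : StronglyMeasurable (fun σ : sphere (0 : Euc N) 1 => u' (‖x‖ • (σ : Euc N))) :=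
    hu'.comp_measurable (by fun_prop)
  have hS1 : ∀ R, ∫⁻ σ : sphere (0 : Euc N) 1, ‖u' (act R (‖x‖ • (σ : Euc N)))‖ₑ ∂τ
      = ∫⁻ σ : sphere (0 : Euc N) 1, ‖u' (‖x‖ • (σ : Euc N))‖ₑ ∂τ := by
    intro R
    have := (sphere_mp (act R)).lintegral_comp (f := fun σ => ‖u' (‖x‖ • (σ : Euc N))‖ₑ)
      hsm.measurable.enorm
    rw [← this]
    simp [hτ]
  have hS2 : ∀ R, ∫ σ : sphere (0 : Euc N) 1, u' (act R (‖x‖ • (σ : Euc N))) ∂τ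
      = ∫ σ : sphere (0 : Euc N) 1, u' (‖x‖ • (σ : Euc N)) ∂τ := by
    intro R
    have h := (sphere_mp (act R))
    have := integral_map (μ := τ) h.measurable.aemeasurable
      (f := fun σ => u' (‖x‖ • (σ : Euc N))) hsm.aestronglyMeasurable
    rw [h.map_eq] at this
    rw [this]
    simp
  have hI : ∫⁻ z, ‖u' (act z.2 (‖x‖ • (z.1 : Euc N)))‖ₑ ∂(τ.prod μ) < ⊤ := by
    rw [lintegral_prod_symm' _ hum.measurable.enorm]
    simp only [hS1]
    simpa using h1
  have hIntg : Integrable (fun z : sphere (0 : Euc N) 1 × G =>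
      u' (act z.2 (‖x‖ • (z.1 : Euc N)))) (τ.prod μ) := ⟨hum.aestronglyMeasurable, hI⟩
  have hfin : ∫⁻ R, ‖u' (act R x)‖ₑ ∂μ < ⊤ := by
    rw [lintegral_prod _ hum.measurable.enorm.aemeasurable] at hI
    simp only [hlaw1, lintegral_const] at hI
    by_contra hcon
    rw [not_lt_top_iff.1 hcon, ENNReal.top_mul (by simpa using hτ0)] at hI
    exact lt_irrefl _ hI
  have hint2 : Integrable (fun R => u' (act R x)) μ :=
    ⟨(hu'.comp_measurable (hm1 x)).aestronglyMeasurable, hfin⟩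
  have hzero : ∫ R, u' (act R x) ∂μ = 0 := by
    have e1 := integral_prod _ hIntg
    have e2 := integral_prod_symm _ hIntg
    simp only [hlaw2, integral_const] at e1
    simp only [hS2, h0, integral_zero] at e2
    rw [e2] at e1
    have : τ.real Set.univ ≠ 0 := by
      simp [Measure.real, ENNReal.toReal_eq_zero_iff, hτ0]
    rcases smul_eq_zero.1 e1.symm with h | h
    · exact absurd h this
    · exact h
  have e : u' x = ∫ R, (u' x - u' (act R x)) ∂μ := by
    rw [integral_sub (integrable_const _) hint2, hzero]; simp
  calc ‖u' x‖ₑ = ‖∫ R, (u' x - u' (act R x)) ∂μ‖ₑ := by rw [← e]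
    _ ≤ _ := enorm_integral_le_lintegral_enorm _

theorem poincare {N : ℕ} (hN : 1 < N) (u : Euc N → ℝ) (g : Fin N → Euc N → ℝ)
    (hS : ∀ x, radialSymmetrization u x = 0)
    (hg : ∀ i, IsWeakPartialDeriv i u (g i)) {δ : ℝ} (hδ : 0 < δ) {p : ℝ} (hp : 1 ≤ p)
    (B B' : Set (Euc N)) (hB : MeasurableSet B) (hB' : MeasurableSet B') (hBr : RadSet B)
    (R : ℝ) (hR : ∀ x ∈ B, ‖x‖ ≤ R) (hBB : ∀ x ∈ B, ∀ t, ‖t‖ < δ → x - t ∈ B') :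
    ∫⁻ x in B, ‖u x‖ₑ ^ p ≤ (N * ENNReal.ofReal (4 * Real.pi * R)) ^ p
      * ∫⁻ x in B', ‖gradNorm1 g x‖ₑ ^ p := by
  have hN0 : 0 < N := by omega
  have : Nonempty (Fin N) := ⟨⟨0, hN0⟩⟩
  have hloc : LocallyIntegrable u volume := (hg ⟨0, hN0⟩).1
  have hum := hloc.aestronglyMeasurable
  set u' := hum.mk u with hu'
  have hu'm : StronglyMeasurable u' := hum.stronglyMeasurable_mk
  have huu : u =ᵐ[volume] u' := hum.ae_eq_mk
  obtain ⟨G, mG, μ, act, hμ, hact, hlaw⟩ := haar_exists (Euc N)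
  have hae : ∀ᵐ x : Euc N, ‖u x‖ₑ ≤ ∫⁻ R, ‖u' x - u' (act R x)‖ₑ ∂μ := by
    filter_upwards [good_radii hN0 u u' hloc hu'm huu, huu] with x hx hxx
    rw [hxx]
    refine avg_bound hN0 u' hu'm μ act hact hlaw x hx.2 ?_
    have h := hS x
    unfold radialSymmetrization at h
    rcases mul_eq_zero.1 h with h | h
    · exfalso
      have h1 : (volume (ball (0 : Euc N) 1)).toReal ≠ 0 :=
        (ENNReal.toReal_pos (measure_ball_pos volume _ one_pos).ne' measure_ball_lt_top.ne).ne'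
      have h2 : (N : ℝ) ≠ 0 := by positivity
      exact (inv_ne_zero (mul_ne_zero h2 h1)) h
    · rw [← h]
      exact integral_congr_ae (hx.1.mono fun σ hσ => hσ.symm)
  have hmG : Measurable (fun z : Euc N × G => ‖u' z.1 - u' (act z.2 z.1)‖ₑ) := by
    have : Measurable (fun z : Euc N × G => act z.2 z.1) :=
      hact.comp (measurable_snd.prodMk measurable_fst)
    exact ((hu'm.measurable.comp measurable_fst).sub (hu'm.measurable.comp this)).enorm
  calc ∫⁻ x in B, ‖u x‖ₑ ^ p
      ≤ ∫⁻ x in B, ∫⁻ R, ‖u' x - u' (act R x)‖ₑ ^ p ∂μ := by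
        refine lintegral_mono_ae (ae_restrict_of_ae (hae.mono fun x hx => ?_))
        refine (ENNReal.rpow_le_rpow hx (by linarith)).trans ?_
        have := jensen_pow μ (fun R => ‖u' x - u' (act R x)‖ₑ)
          (hmG.comp measurable_prodMk_left).aemeasurable hp
        simpa using this
    _ = ∫⁻ R, (∫⁻ x in B, ‖u' x - u' (act R x)‖ₑ ^ p) ∂μ :=
        lintegral_lintegral_swap (hmG.pow_const p).aemeasurable
    _ ≤ ∫⁻ _, (N * ENNReal.ofReal (4 * Real.pi * R)) ^ p
      * (∫⁻ x in B', ‖gradNorm1 g x‖ₑ ^ p) ∂μ := by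
        refine lintegral_mono fun S => ?_
        refine le_trans (le_of_eq ?_) (iso_weak hN (act S) u g hg δ hδ hp B B' hB hB' hBr R hR hBB)
        refine lintegral_congr_ae (ae_restrict_of_ae ?_)
        have := (act S).measurePreserving.quasiMeasurePreserving.ae huu
        filter_upwards [huu, this] with x h1 h2
        rw [h1, h2]
    _ = _ := by simp

/-- Morrey kernel estimate. -/
theorem morrey_kernel {N : ℕ} (hN : 0 < N) (φ : Euc N → ℝ) (hφ : ContDiff ℝ 1 φ)
    (hs : Function.support φ ⊆ ball 0 4) (x : Euc N) (hx : x ∈ ball (0 : Euc N) 4) :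
    (volume : Measure (Euc N)).toSphere Set.univ * ‖φ x‖ₑ ≤
      ∫⁻ y in ball (0 : Euc N) 8, ‖fderiv ℝ φ (x + y)‖ₑ * ENNReal.ofReal (‖y‖ ^ (1 - (N : ℝ))) := by
  have hc : Continuous (fderiv ℝ φ) := hφ.continuous_fderiv one_ne_zero
  set F : Euc N → ℝ≥0∞ := (ball (0 : Euc N) 8).indicator
    (fun y => ‖fderiv ℝ φ (x + y)‖ₑ * ENNReal.ofReal (‖y‖ ^ (1 - (N : ℝ)))) with hFdef
  have hF : Measurable F := by
    have a1 : Measurable (fun y => ‖fderiv ℝ φ (x + y)‖ₑ) :=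
      (hc.comp (continuous_const.add continuous_id)).measurable.enorm
    have a2 : Measurable (fun y : Euc N => ENNReal.ofReal (‖y‖ ^ (1 - (N : ℝ)))) :=
      (measurable_norm.pow_const _).ennreal_ofReal
    exact (a1.mul a2).indicator measurableSet_ball
  rw [← lintegral_indicator measurableSet_ball, polar_lintegral_s10 hN _ hF]
  have hdens : Measurable (fun r : Set.Ioi (0 : ℝ) => ENNReal.ofReal ((r : ℝ) ^ (N - 1))) :=
    (measurable_subtype_coe.pow_const _).ennreal_ofReal
  have hm : Measurable (fun z : Set.Ioi (0 : ℝ) × sphere (0 : Euc N) 1 =>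
      F ((z.1 : ℝ) • (z.2 : Euc N))) := hF.comp (by fun_prop)
  rw [Measure.volumeIoiPow, lintegral_withDensity_eq_lintegral_mul _ hdens
    hm.lintegral_prod_right']
  simp only [Pi.mul_apply]
  have hm2 : ∀ r : Set.Ioi (0 : ℝ), Measurable (fun σ : sphere (0 : Euc N) 1 =>
      F ((r : ℝ) • (σ : Euc N))) := fun r => hF.comp (by fun_prop)
  simp_rw [← lintegral_const_mul _ (hm2 _)]
  have hsf : SFinite (Measure.comap Subtype.val volume : Measure (Set.Ioi (0 : ℝ))) := by
    have : (Measure.comap Subtype.val volume : Measure (Set.Ioi (0 : ℝ)))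
        = Measure.volumeIoiPow 0 := by
      simp [Measure.volumeIoiPow]
    rw [this]; infer_instance
  rw [lintegral_lintegral_swap ((hdens.comp measurable_fst).mul hm).aemeasurable]
  rw [mul_comm, ← lintegral_const]
  refine lintegral_mono fun σ => ?_
  have hσ : ‖(σ : Euc N)‖ = 1 := by simp
  rw [lintegral_subtype_comap measurableSet_Ioi
    (fun r : ℝ => ENNReal.ofReal (r ^ (N - 1)) * F (r • (σ : Euc N)))]
  have h8 : φ (x + (8 : ℝ) • (σ : Euc N)) = 0 := by
    by_contra hne
    have h1 : x + (8 : ℝ) • (σ : Euc N) ∈ ball (0 : Euc N) 4 := hs hne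
    rw [mem_ball_zero_iff] at h1 hx
    have h2 : ‖(8 : ℝ) • (σ : Euc N)‖ = 8 := by rw [norm_smul, hσ]; simp
    have h3 := norm_sub_norm_le ((8 : ℝ) • (σ : Euc N)) (-x)
    rw [sub_neg_eq_add, add_comm _ x, norm_neg, h2] at h3
    linarith
  have hd : ∀ r : ℝ, HasDerivAt (fun r : ℝ => φ (x + r • (σ : Euc N)))
      (fderiv ℝ φ (x + r • (σ : Euc N)) (σ : Euc N)) r := by
    intro r
    have h1 : HasFDerivAt φ (fderiv ℝ φ (x + r • (σ : Euc N))) (x + r • (σ : Euc N)) :=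
      (hφ.differentiable one_ne_zero _).hasFDerivAt
    have h2 : HasDerivAt (fun r : ℝ => x + r • (σ : Euc N)) (σ : Euc N) r := by
      simpa using ((hasDerivAt_id r).smul_const (σ : Euc N)).const_add x
    exact h1.comp_hasDerivAt r h2
  have hcd : Continuous (fun r : ℝ => fderiv ℝ φ (x + r • (σ : Euc N)) (σ : Euc N)) :=
    (hc.comp (by fun_prop)).clm_apply continuous_const
  have hftc := intervalIntegral.integral_eq_sub_of_hasDerivAt (a := 0) (b := 8)
    (fun r _ => hd r) (hcd.intervalIntegrable _ _)
  simp only [h8, zero_smul, add_zero, zero_sub] at hftc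
  rw [intervalIntegral.integral_of_le (by norm_num)] at hftc
  have : ‖φ x‖ₑ ≤ ∫⁻ r in Set.Ioc (0 : ℝ) 8, ‖fderiv ℝ φ (x + r • (σ : Euc N)) (σ : Euc N)‖ₑ := by
    rw [← enorm_neg, ← hftc]
    exact enorm_integral_le_lintegral_enorm _
  refine this.trans ?_
  rw [← restrict_Ioo_eq_restrict_Ioc]
  refine (setLIntegral_mono' measurableSet_Ioo ?_).trans
    (lintegral_mono_set (fun r (hr : r ∈ Set.Ioo (0 : ℝ) 8) => hr.1))
  intro r hr
  have hrn : ‖r • (σ : Euc N)‖ = r := by rw [norm_smul, hσ]; simp [abs_of_pos hr.1]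
  have hmem : r • (σ : Euc N) ∈ ball (0 : Euc N) 8 := by
    rw [mem_ball_zero_iff, hrn]; exact hr.2
  rw [hFdef, Set.indicator_of_mem hmem, hrn, mul_comm, mul_assoc, ← ENNReal.ofReal_mul
    (Real.rpow_nonneg hr.1.le _)]
  have : r ^ (1 - (N : ℝ)) * r ^ (N - 1) = 1 := by
    rw [← Real.rpow_natCast, ← Real.rpow_add hr.1, Nat.cast_sub hN]; simp
  rw [this, ENNReal.ofReal_one, mul_one]
  have := (fderiv ℝ φ (x + r • (σ : Euc N))).le_opENorm (σ : Euc N)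
  have hσe : ‖(σ : Euc N)‖ₑ = 1 := by rw [← ofReal_norm, hσ]; simp
  rwa [hσe, mul_one] at this

theorem kernel_finite {N : ℕ} (hN : 0 < N) {s : ℝ} (hs : -(N : ℝ) < s) :
    ∫⁻ y in ball (0 : Euc N) 8, ENNReal.ofReal (‖y‖ ^ s) < ⊤ := by
  have : Nonempty (Fin N) := ⟨⟨0, hN⟩⟩
  have h : IntegrableOn (fun x : Euc N => (fun r : ℝ => r ^ s) ‖x‖) (ball (0 : Euc N) 8) volume := by
    rw [integrableOn_fun_norm_addHaar volume (f := fun r : ℝ => r ^ s)]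
    have h2 := (intervalIntegral.integrableOn_Ioo_rpow_iff (s := (N : ℝ) - 1 + s)
      (t := 8) (by norm_num)).2 (by linarith)
    refine h2.congr_fun (fun r hr => ?_) measurableSet_Ioo
    simp only [finrank_euclideanSpace, Fintype.card_fin, smul_eq_mul]
    rw [← Real.rpow_natCast, ← Real.rpow_add hr.1, Nat.cast_sub hN]; simp
  exact h.lintegral_lt_top

/-- Morrey: sup bound. -/
theorem morrey {N : ℕ} (hN : 1 < N) {p : ℝ} (hp : (N : ℝ) < p) :
    ∃ C : ℝ≥0∞, C ≠ ⊤ ∧ ∀ φ : Euc N → ℝ, ContDiff ℝ 1 φ → Function.support φ ⊆ ball 0 4 →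
      eLpNorm φ ⊤ volume ≤ C * eLpNorm (fderiv ℝ φ) (ENNReal.ofReal p) volume := by
  have hN0 : 0 < N := by omega
  have : Nonempty (Fin N) := ⟨⟨0, hN0⟩⟩
  have hN1 : (1 : ℝ) < N := by exact_mod_cast hN
  have hp1 : 1 < p := by linarith
  have hpq := Real.HolderConjugate.conjExponent hp1
  set p' := p.conjExponent with hp'
  set τ := (volume : Measure (Euc N)).toSphere Set.univ with hτ
  have hτ0 : τ ≠ 0 := by
    exact Measure.measure_univ_ne_zero.2 (Measure.toSphere_ne_zero (volume : Measure (Euc N)))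
  have hτt : τ ≠ ⊤ := measure_ne_top _ _
  have hp'0 : 0 < p' := hpq.symm.pos
  have hfin : ∫⁻ y in ball (0 : Euc N) 8, (ENNReal.ofReal (‖y‖ ^ (1 - (N : ℝ)))) ^ p' < ⊤ := by
    have : -(N : ℝ) < (1 - N) * p' := by
      rw [hp', Real.conjExponent]
      have : 0 < p - 1 := by linarith
      rw [mul_div_assoc', lt_div_iff₀ this]
      nlinarith
    refine lt_of_le_of_lt (lintegral_mono fun y => ?_) (kernel_finite hN0 this)
    rw [ENNReal.ofReal_rpow_of_nonneg (Real.rpow_nonneg (norm_nonneg _) _) hp'0.le,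
      ← Real.rpow_mul (norm_nonneg _)]
  set K := (∫⁻ y in ball (0 : Euc N) 8, (ENNReal.ofReal (‖y‖ ^ (1 - (N : ℝ)))) ^ p') ^ (1 / p')
    with hK
  refine ⟨τ⁻¹ * K, ENNReal.mul_ne_top (ENNReal.inv_ne_top.2 hτ0)
    (ENNReal.rpow_ne_top_of_nonneg (by positivity) hfin.ne), ?_⟩
  intro φ hφ hs
  rw [eLpNorm_exponent_top]
  refine eLpNormEssSup_le_of_ae_enorm_bound (Eventually.of_forall fun x => ?_)
  by_cases hx : x ∈ ball (0 : Euc N) 4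
  swap
  · have : φ x = 0 := by
      by_contra h; exact hx (hs h)
    simp [this]
  have hc : Continuous (fderiv ℝ φ) := hφ.continuous_fderiv one_ne_zero
  have h1 := morrey_kernel hN0 φ hφ hs x hx
  have h2 := ENNReal.lintegral_mul_le_Lp_mul_Lq (volume.restrict (ball (0 : Euc N) 8)) hpq
    (f := fun y => ‖fderiv ℝ φ (x + y)‖ₑ) (g := fun y => ENNReal.ofReal (‖y‖ ^ (1 - (N : ℝ))))
    (hc.comp (continuous_const.add continuous_id)).measurable.enorm.aemeasurable
    (measurable_norm.pow_const _).ennreal_ofReal.aemeasurable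
  have h3 : (∫⁻ y in ball (0 : Euc N) 8, ‖fderiv ℝ φ (x + y)‖ₑ ^ p) ^ (1 / p)
      ≤ eLpNorm (fderiv ℝ φ) (ENNReal.ofReal p) volume := by
    rw [eLpNorm_ofReal_eq _ _ hp1.le]
    refine ENNReal.rpow_le_rpow ?_ (by positivity)
    refine (setLIntegral_le_lintegral _ _).trans (le_of_eq ?_)
    exact lintegral_add_left_eq_self (fun y => ‖fderiv ℝ φ y‖ₑ ^ p) x
  have h4 : τ * ‖φ x‖ₑ ≤ eLpNorm (fderiv ℝ φ) (ENNReal.ofReal p) volume * K :=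
    h1.trans (h2.trans (mul_le_mul_left h3 _))
  calc ‖φ x‖ₑ = τ⁻¹ * (τ * ‖φ x‖ₑ) := by
        rw [← mul_assoc, ENNReal.inv_mul_cancel hτ0 hτt, one_mul]
    _ ≤ τ⁻¹ * (eLpNorm (fderiv ℝ φ) (ENNReal.ofReal p) volume * K) := by gcongr
    _ = _ := by ring

/-- Sobolev, finite exponent. -/
theorem sobolev_fin {N : ℕ} (hN : 1 < N) {p q : ℝ} (hp : 1 ≤ p) (hpq : p ≤ q)
    (hq : p⁻¹ - (N : ℝ)⁻¹ ≤ q⁻¹) :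
    ∃ C : ℝ≥0∞, C ≠ ⊤ ∧ ∀ φ : Euc N → ℝ, ContDiff ℝ 1 φ → Function.support φ ⊆ ball 0 4 →
      eLpNorm φ (ENNReal.ofReal q) volume ≤
        C * eLpNorm (fderiv ℝ φ) (ENNReal.ofReal p) volume := by
  have hN1 : (2 : ℝ) ≤ N := by exact_mod_cast hN
  have main : ∀ s : ℝ, 1 ≤ s → s < N → s ≤ p → s⁻¹ - (N : ℝ)⁻¹ ≤ q⁻¹ → 
    ∃ C : ℝ≥0∞, C ≠ ⊤ ∧ ∀ φ : Euc N → ℝ, ContDiff ℝ 1 φ → Function.support φ ⊆ ball 0 4 →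
      eLpNorm φ (ENNReal.ofReal q) volume ≤
        C * eLpNorm (fderiv ℝ φ) (ENNReal.ofReal p) volume := by
    intro s hs1 hsN hsp hsq
    set V := volume (closedBall (0 : Euc N) 4)
    set C1 := eLpNormLESNormFDerivOfLeConst ℝ (volume : Measure (Euc N)) (ball (0 : Euc N) 4)
      s.toNNReal q.toNNReal
    have hexp : 0 ≤ 1 / s - 1 / p := by
      rw [sub_nonneg]; exact one_div_le_one_div_of_le (by linarith) hsp
    refine ⟨C1 * V ^ (1 / s - 1 / p), ENNReal.mul_ne_top ENNReal.coe_ne_top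
      (ENNReal.rpow_ne_top_of_nonneg hexp measure_closedBall_lt_top.ne), ?_⟩
    intro φ hφ hsupp
    have h1 := eLpNorm_le_eLpNorm_fderiv_of_le (volume : Measure (Euc N)) hφ hsupp
      (p := s.toNNReal) (q := q.toNNReal) (by simpa using hs1)
      (by rw [← NNReal.coe_lt_coe, Real.coe_toNNReal _ (by linarith)]; simpa using hsN)
      (by
        rw [NNReal.coe_inv, Real.coe_toNNReal _ (by linarith), Real.coe_toNNReal _ (by linarith)]
        simpa using hsq) isBounded_ball
    have hsub : Function.support (fderiv ℝ φ) ⊆ closedBall (0 : Euc N) 4 :=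
      (support_fderiv_subset ℝ).trans
        ((closure_mono hsupp).trans closure_ball_subset_closedBall)
    have h2 := eLpNorm_le_eLpNorm_mul_rpow_measure_univ (p := ENNReal.ofReal s)
      (q := ENNReal.ofReal p) (ENNReal.ofReal_le_ofReal hsp)
      (μ := (volume : Measure (Euc N)).restrict (closedBall 0 4)) (f := fderiv ℝ φ)
      (hφ.continuous_fderiv one_ne_zero).aestronglyMeasurable
    have h3 : ∀ r : ℝ≥0∞, eLpNorm (fderiv ℝ φ) r (volume.restrict (closedBall 0 4))
        = eLpNorm (fderiv ℝ φ) r volume := fun r =>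
      eLpNorm_restrict_eq_of_support_subset (ε := Euc N →L[ℝ] ℝ) hsub
    rw [h3, h3,
      ENNReal.toReal_ofReal (by linarith), ENNReal.toReal_ofReal (by linarith),
      Measure.restrict_apply_univ] at h2
    calc eLpNorm φ (ENNReal.ofReal q) volume ≤ C1 * eLpNorm (fderiv ℝ φ) (ENNReal.ofReal s) volume := h1
      _ ≤ C1 * (eLpNorm (fderiv ℝ φ) (ENNReal.ofReal p) volume * V ^ (1 / s - 1 / p)) := by gcongr
      _ = _ := by ring
  by_cases hpN : p < N
  · exact main p hp hpN le_rfl hq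
  · push Not at hpN
    have hq0 : 0 < q := by linarith
    have hNi : (N : ℝ)⁻¹ ≤ 1 / 2 := by rw [one_div]; exact inv_anti₀ (by norm_num) hN1
    have hqi : q⁻¹ ≤ 1 / 2 := by rw [one_div]; exact inv_anti₀ (by norm_num) (by linarith)
    have hqp : 0 < q⁻¹ := by positivity
    have hNp : 0 < (N : ℝ)⁻¹ := by positivity
    have hlt : ((N : ℝ)⁻¹ + q⁻¹)⁻¹ < N := by
      rw [inv_lt_comm₀ (by positivity) (by positivity)]; linarith
    refine main ((N : ℝ)⁻¹ + q⁻¹)⁻¹ ?_ hlt (by linarith) ?_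
    · rw [one_le_inv₀ (by positivity)]; linarith
    · rw [inv_inv]; linarith

theorem Ijp_cases {N : ℕ} (hN : 1 < N) {p : ℝ} (hp : 1 ≤ p) {q : ℝ≥0∞} (hq : q ∈ Ijp N 1 p) :
    (q = ⊤ ∧ (N : ℝ) < p) ∨
    (∃ q' : ℝ, q = ENNReal.ofReal q' ∧ p ≤ q' ∧ p⁻¹ - (N : ℝ)⁻¹ ≤ q'⁻¹) := by
  have hN0 : (0 : ℝ) < N := by positivity
  have key : ENNReal.ofReal p ≤ q → q ≠ ⊤ → (p⁻¹ - (N : ℝ)⁻¹ ≤ (q.toReal)⁻¹) →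
    (∃ q' : ℝ, q = ENNReal.ofReal q' ∧ p ≤ q' ∧ p⁻¹ - (N : ℝ)⁻¹ ≤ q'⁻¹) := by
    intro h1 h2 h3
    refine ⟨q.toReal, (ENNReal.ofReal_toReal h2).symm, ?_, h3⟩
    exact (ENNReal.ofReal_le_iff_le_toReal h2).1 h1
  have triv : (N : ℝ) ≤ p → p⁻¹ - (N : ℝ)⁻¹ ≤ (q.toReal)⁻¹ := by
    intro h
    have h1 : p⁻¹ ≤ (N : ℝ)⁻¹ := inv_anti₀ hN0 h
    have h2 : 0 ≤ (q.toReal)⁻¹ := by positivity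
    linarith
  unfold Ijp at hq
  simp only [Nat.cast_one, div_one, one_mul] at hq
  split_ifs at hq with h1 h2
  · exact Or.inr (key hq.1 hq.2.ne (triv h1.1.ge))
  · have hq2 : q ≠ ⊤ := ne_top_of_le_ne_top ENNReal.ofReal_ne_top hq.2
    refine Or.inr (key hq.1 hq2 ?_)
    have hd : 0 < (N : ℝ) - p := by linarith
    have hqp : 0 < q.toReal := by
      have := (ENNReal.ofReal_le_iff_le_toReal hq2).1 hq.1
      linarith
    have h3 : q.toReal ≤ N * p / (N - p) := by
      have := ENNReal.toReal_mono ENNReal.ofReal_ne_top hq.2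
      rwa [ENNReal.toReal_ofReal (by positivity)] at this
    have h4 := inv_anti₀ hqp h3
    refine le_trans (le_of_eq ?_) h4
    field_simp
  · have hNp : (N : ℝ) < p := by
      rcases lt_or_eq_of_le (not_lt.1 h2) with h | h
      · exact h
      · exact absurd ⟨h.symm, hN⟩ h1
    by_cases hqt : q = ⊤
    · exact Or.inl ⟨hqt, hNp⟩
    · exact Or.inr (key hq.1 hqt (triv hNp.le))

theorem sobolev_core {N : ℕ} (hN : 1 < N) {p : ℝ} (hp : 1 ≤ p) {q : ℝ≥0∞} (hq : q ∈ Ijp N 1 p) :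
    ∃ C : ℝ≥0∞, C ≠ ⊤ ∧ ∀ φ : Euc N → ℝ, ContDiff ℝ 1 φ → Function.support φ ⊆ ball 0 4 →
      eLpNorm φ q volume ≤ C * eLpNorm (fderiv ℝ φ) (ENNReal.ofReal p) volume := by
  rcases Ijp_cases hN hp hq with ⟨rfl, h⟩ | ⟨q', rfl, h1, h2⟩
  · exact morrey hN h
  · exact sobolev_fin hN hp h1 h2

/-- Half open shells. -/
def Shell (N : ℕ) (r s : ℝ) : Set (Euc N) := {x | r ≤ ‖x‖ ∧ ‖x‖ < s}

theorem Shell_meas (N : ℕ) (r s : ℝ) : MeasurableSet (Shell N r s) :=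
  (measurableSet_le measurable_const measurable_norm).inter
    (measurableSet_lt measurable_norm measurable_const)

theorem exists_cutoff (N : ℕ) : ∃ (χ : Euc N → ℝ) (M : ℝ), 0 ≤ M ∧ ContDiff ℝ 1 χ ∧
    (∀ x ∈ Shell N 1 2, χ x = 1) ∧ (∀ x, |χ x| ≤ 1) ∧ (∀ x, ‖fderiv ℝ χ x‖ ≤ M) ∧
    Function.support χ ⊆ ball 0 3 ∧ tsupport χ ⊆ Shell N (3/4) (7/2) := by
  let f1 : ContDiffBump (0 : Euc N) := ⟨2, 3, by norm_num, by norm_num⟩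
  let f2 : ContDiffBump (0 : Euc N) := ⟨3/4, 1, by norm_num, by norm_num⟩
  have hs : Function.support (fun x => f1 x * (1 - f2 x)) ⊆ {x | 3/4 ≤ ‖x‖ ∧ ‖x‖ < 3} := by
    intro x hx
    simp only [Function.mem_support, ne_eq, mul_eq_zero, not_or] at hx
    constructor
    · by_contra h
      apply hx.2
      rw [f2.one_of_mem_closedBall]
      · simp
      · simp only [mem_closedBall, dist_zero_right]; push Not at h; exact h.le
    · have : x ∈ Function.support f1 := hx.1
      rw [f1.support_eq] at this
      simpa using this
  have hts : tsupport (fun x => f1 x * (1 - f2 x)) ⊆ {x : Euc N | 3/4 ≤ ‖x‖ ∧ ‖x‖ ≤ 3} := by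
    refine closure_minimal (hs.trans fun x hx => ⟨hx.1, hx.2.le⟩) ?_
    exact (isClosed_le continuous_const continuous_norm).inter
      (isClosed_le continuous_norm continuous_const)
  have hcd : ContDiff ℝ 1 (fun x => f1 x * (1 - f2 x)) :=
    f1.contDiff.mul (contDiff_const.sub f2.contDiff)
  have hcs : HasCompactSupport (fun x => f1 x * (1 - f2 x)) :=
    HasCompactSupport.of_support_subset_isCompact (isCompact_closedBall (0 : Euc N) 3)
      (hs.trans fun x hx => by simpa using hx.2.le)
  obtain ⟨M, hM⟩ := (hcd.continuous_fderiv one_ne_zero).bounded_above_of_compact_support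
    (hcs.fderiv (𝕜 := ℝ))
  refine ⟨fun x => f1 x * (1 - f2 x), M, (norm_nonneg _).trans (hM 0), hcd, ?_, ?_, hM, ?_, ?_⟩
  · intro x hx
    have h1 : f1 x = 1 := f1.one_of_mem_closedBall (by simpa using hx.2.le)
    have h2 : f2 x = 0 := f2.zero_of_le_dist (by simpa using hx.1)
    simp [h1, h2]
  · intro x
    have a1 := f1.nonneg (x := x)
    have a2 := f2.nonneg (x := x)
    have a3 := f1.le_one (x := x)
    have a4 := f2.le_one (x := x)
    rw [abs_le]; constructor <;> nlinarith
  · exact fun x hx => by simpa using (hs hx).2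
  · exact fun x hx => ⟨(hts hx).1, lt_of_le_of_lt (hts hx).2 (by norm_num)⟩

theorem unit_smooth {N : ℕ} (hN : 1 < N) {p : ℝ} (hp : 1 ≤ p) {q : ℝ≥0∞} (hq : q ∈ Ijp N 1 p) :
    ∃ C : ℝ≥0∞, C ≠ ⊤ ∧ ∀ w : Euc N → ℝ, ContDiff ℝ 1 w →
      eLpNorm w q (volume.restrict (Shell N 1 2)) ≤
        C * (eLpNorm (fderiv ℝ w) (ENNReal.ofReal p) (volume.restrict (Shell N (3/4) (7/2)))
          + eLpNorm w (ENNReal.ofReal p) (volume.restrict (Shell N (3/4) (7/2)))) := by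
  obtain ⟨C, hC, hmain⟩ := sobolev_core hN hp hq
  obtain ⟨χ, M, hM0, hχ, hχ1, hχb, hχM, hχs, hχt⟩ := exists_cutoff N
  refine ⟨C * ENNReal.ofReal (1 + M), ENNReal.mul_ne_top hC ENNReal.ofReal_ne_top, ?_⟩
  intro w hw
  set S := Shell N (3/4) (7/2)
  have hφ : ContDiff ℝ 1 (fun x => χ x * w x) := hχ.mul hw
  have h1 := hmain (fun x => χ x * w x) hφ (by
    intro x hx
    have : χ x ≠ 0 := fun h => hx (by simp [h])
    exact ball_subset_ball (by norm_num) (hχs this))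
  have h0 : eLpNorm w q (volume.restrict (Shell N 1 2)) ≤ eLpNorm (fun x => χ x * w x) q volume := by
    refine le_trans (le_of_eq ?_) (eLpNorm_mono_measure _ (Measure.restrict_le_self (s := Shell N 1 2)))
    refine eLpNorm_congr_ae ?_
    filter_upwards [ae_restrict_mem (Shell_meas N 1 2)] with x hx
    simp [hχ1 x hx]
  have hsub : Function.support (fderiv ℝ (fun x => χ x * w x)) ⊆ S := by
    refine (support_fderiv_subset ℝ).trans (Set.Subset.trans ?_ hχt)
    exact closure_mono fun x hx => fun h => hx (by simp [h])
  have h2 : eLpNorm (fderiv ℝ (fun x => χ x * w x)) (ENNReal.ofReal p) volume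
      = eLpNorm (fderiv ℝ (fun x => χ x * w x)) (ENNReal.ofReal p) (volume.restrict S) :=
    (eLpNorm_restrict_eq_of_support_subset (ε := Euc N →L[ℝ] ℝ) hsub).symm
  have hdiff : ∀ x, ‖fderiv ℝ (fun x => χ x * w x) x‖ ≤ (1 + M) * (‖fderiv ℝ w x‖ + ‖w x‖) := by
    intro x
    rw [fderiv_fun_mul (hχ.differentiable one_ne_zero x) (hw.differentiable one_ne_zero x)]
    refine (norm_add_le _ _).trans ?_
    rw [norm_smul, norm_smul, Real.norm_eq_abs]
    have a1 := hχb x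
    have a2 := hχM x
    have a3 := norm_nonneg (w x)
    have a4 := norm_nonneg (fderiv ℝ w x)
    have a5 := abs_nonneg (χ x)
    nlinarith [mul_le_mul_of_nonneg_right a1 a4, mul_le_mul_of_nonneg_left a2 a3, mul_nonneg hM0 a4]
  have h3 : eLpNorm (fderiv ℝ (fun x => χ x * w x)) (ENNReal.ofReal p) (volume.restrict S)
      ≤ ENNReal.ofReal (1 + M) * eLpNorm (fun x => ‖fderiv ℝ w x‖ + ‖w x‖) (ENNReal.ofReal p)
        (volume.restrict S) := by
    refine eLpNorm_le_mul_eLpNorm_of_ae_le_mul (Eventually.of_forall fun x => ?_) _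
    rw [Real.norm_of_nonneg (by positivity)]
    exact hdiff x
  have hwm : AEStronglyMeasurable (fun x => ‖w x‖) (volume.restrict S) :=
    hw.continuous.norm.aestronglyMeasurable
  have hfm : AEStronglyMeasurable (fun x => ‖fderiv ℝ w x‖) (volume.restrict S) :=
    (hw.continuous_fderiv one_ne_zero).norm.aestronglyMeasurable
  have h4 := eLpNorm_add_le hfm hwm (p := ENNReal.ofReal p) (by simpa using hp)
  rw [eLpNorm_norm, eLpNorm_norm] at h4
  calc _ ≤ _ := h0
    _ ≤ _ := h1
    _ ≤ C * (ENNReal.ofReal (1 + M) * (eLpNorm (fderiv ℝ w) (ENNReal.ofReal p) (volume.restrict S)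
          + eLpNorm w (ENNReal.ofReal p) (volume.restrict S))) := by
        rw [h2]; gcongr; exact h3.trans (by gcongr; exact h4)
    _ = _ := by ring

theorem shell_step {N : ℕ} {r s r' s' δ : ℝ} (h1 : r' + δ ≤ r) (h2 : s + δ ≤ s') :
    ∀ x ∈ Shell N r s, ∀ t : Euc N, ‖t‖ < δ → x - t ∈ Shell N r' s' := by
  intro x hx t ht
  have a1 := norm_sub_norm_le x t
  have a2 := norm_sub_le x t
  exact ⟨by linarith [hx.1], by linarith [hx.2]⟩

theorem unit_weak {N : ℕ} (hN : 1 < N) {p : ℝ} (hp : 1 ≤ p) {q : ℝ≥0∞} (hq : q ∈ Ijp N 1 p) :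
    ∃ C : ℝ≥0∞, C ≠ ⊤ ∧ ∀ (u : Euc N → ℝ) (g : Fin N → Euc N → ℝ),
      (∀ x, radialSymmetrization u x = 0) → (∀ i, IsWeakPartialDeriv i u (g i)) →
      eLpNorm u q (volume.restrict (Shell N 1 2)) ≤
        C * eLpNorm (gradNorm1 g) (ENNReal.ofReal p) (volume.restrict (Shell N (1/4) 8)) := by
  obtain ⟨C, hC, hmain⟩ := unit_smooth hN hp hq
  have hp0 : 0 < p := by linarith
  refine ⟨C * (1 + N * ENNReal.ofReal (4 * Real.pi * 4)), ENNReal.mul_ne_top hC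
    (ENNReal.add_ne_top.2 ⟨one_ne_top, ENNReal.mul_ne_top (by simp) ENNReal.ofReal_ne_top⟩), ?_⟩
  intro u g hS hg
  obtain ⟨w, hwc, hwt, hwb⟩ := moll_seq (by omega : 0 < N) u g hg (1/8) (by norm_num)
  set K : ℝ≥0∞ := N * ENNReal.ofReal (4 * Real.pi * 4)
  set D := eLpNorm (gradNorm1 g) (ENNReal.ofReal p) (volume.restrict (Shell N (1/4) 8)) with hD
  have hu2 : (∫⁻ x in Shell N (1/2) 4, ‖u x‖ₑ ^ p) ^ (1 / p) ≤ K * D := by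
    have h := poincare hN u g hS hg (δ := 1/8) (by norm_num) hp (Shell N (1/2) 4) (Shell N (1/4) 8)
      (Shell_meas _ _ _) (Shell_meas _ _ _)
      (fun x y h => by simp only [Shell, Set.mem_ofPred_eq, h]) 4 (fun x hx => hx.2.le)
      (shell_step (by norm_num) (by norm_num))
    refine (ENNReal.rpow_le_rpow h (by positivity : 0 ≤ 1 / p)).trans (le_of_eq ?_)
    rw [ENNReal.mul_rpow_of_nonneg _ _ (by positivity), ← ENNReal.rpow_mul,
      mul_one_div_cancel hp0.ne', ENNReal.rpow_one, hD, eLpNorm_ofReal_eq _ _ hp]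
  have hg2 : (∫⁻ x in Shell N (1/2) 4, ‖gradNorm1 g x‖ₑ ^ p) ^ (1 / p) ≤ D := by
    rw [hD, eLpNorm_ofReal_eq _ _ hp]
    refine ENNReal.rpow_le_rpow (lintegral_mono_set fun x hx => ?_) (by positivity)
    exact ⟨by linarith [hx.1], by linarith [hx.2]⟩
  have hn : ∀ n, eLpNorm (w n) q (volume.restrict (Shell N 1 2)) ≤ C * (1 + K) * D := by
    intro n
    have hb := hwb p hp (Shell N (3/4) (7/2)) (Shell N (1/2) 4) (Shell_meas _ _ _) (Shell_meas _ _ _)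
      (shell_step (by norm_num) (by norm_num)) n
    refine (hmain (w n) (hwc n)).trans ?_
    rw [eLpNorm_ofReal_eq _ _ hp, eLpNorm_ofReal_eq _ _ hp, mul_assoc]
    gcongr
    rw [add_mul, one_mul]
    exact add_le_add ((ENNReal.rpow_le_rpow hb.2 (by positivity)).trans hg2)
      ((ENNReal.rpow_le_rpow hb.1 (by positivity)).trans hu2)
  refine (Lp.eLpNorm_lim_le_liminf_eLpNorm (fun n => (hwc n).continuous.aestronglyMeasurable) u
    (ae_restrict_of_ae hwt)).trans ?_
  exact liminf_le_of_frequently_le' (Frequently.of_forall hn)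

theorem locInt_scale {N : ℕ} {u : Euc N → ℝ} (hu : LocallyIntegrable u volume) {l : ℝ} (hl : 0 < l) :
    LocallyIntegrable (fun x => u (l • x)) volume := by
  rw [locallyIntegrable_iff] at hu ⊢
  intro K hK
  have hK' : IsCompact ((fun x => l • x) '' K) := hK.image (by fun_prop)
  have h1 := hu _ hK'
  rw [← integrable_indicator_iff hK'.measurableSet] at h1
  have h2 := h1.comp_smul hl.ne'
  rw [← integrable_indicator_iff hK.measurableSet]
  refine h2.congr (Eventually.of_forall fun x => ?_)
  have hinj : l • x ∈ (fun x => l • x) '' K ↔ x ∈ K := by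
    constructor
    · rintro ⟨y, hy, h⟩
      have : y = x := smul_right_injective _ hl.ne' h
      rwa [← this]
    · exact fun h => ⟨x, h, rfl⟩
  by_cases hx : x ∈ K
  · rw [Set.indicator_of_mem hx]; exact Set.indicator_of_mem (hinj.2 hx) _
  · rw [Set.indicator_of_notMem hx]; exact Set.indicator_of_notMem (fun h => hx (hinj.1 h)) _

theorem weak_scale {N : ℕ} {i : Fin N} {u g : Euc N → ℝ} (h : IsWeakPartialDeriv i u g)
    {l : ℝ} (hl : 0 < l) :
    IsWeakPartialDeriv i (fun x => u (l • x)) (fun x => l * g (l • x)) := by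
  obtain ⟨h1, h2, h3⟩ := h
  refine ⟨locInt_scale h1 hl, (locInt_scale h2 hl).smul l, ?_⟩
  intro φ hφ hc
  have hl0 := hl.ne'
  have e := h3 (fun y => φ (l⁻¹ • y)) (hφ.comp (contDiff_const_smul _))
    (hc.comp_homeomorph (Homeomorph.smulOfNeZero l⁻¹ (inv_ne_zero hl0)))
  simp only [pderivList, List.length_cons, List.length_nil, zero_add, pow_one] at e ⊢
  have hd : ∀ y, fderiv ℝ (fun y => φ (l⁻¹ • y)) y (EuclideanSpace.single i 1)
      = l⁻¹ * fderiv ℝ φ (l⁻¹ • y) (EuclideanSpace.single i 1) := by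
    intro y
    have ha : HasFDerivAt (fun y : Euc N => l⁻¹ • y) (l⁻¹ • ContinuousLinearMap.id ℝ (Euc N)) y :=
      (hasFDerivAt_id y).const_smul l⁻¹
    have hb : HasFDerivAt φ (fderiv ℝ φ (l⁻¹ • y)) (l⁻¹ • y) :=
      (hφ.differentiable (by simp) _).hasFDerivAt
    have := (hb.comp y ha).fderiv
    have e2 : (fun y => φ (l⁻¹ • y)) = φ ∘ fun y => l⁻¹ • y := rfl
    rw [e2, this]
    simp
  simp only [hd] at e
  have i1 := Measure.integral_comp_smul (volume : Measure (Euc N))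
    (fun y => u y * (l⁻¹ * fderiv ℝ φ (l⁻¹ • y) (EuclideanSpace.single i 1))) l
  have i2 := Measure.integral_comp_smul (volume : Measure (Euc N)) (fun y => g y * φ (l⁻¹ • y)) l
  simp only [smul_smul, inv_mul_cancel₀ hl0, one_smul] at i1 i2
  rw [e] at i1
  have j1 : ∫ x, u (l • x) * fderiv ℝ φ x (EuclideanSpace.single i 1)
      = l * ∫ x, u (l • x) * (l⁻¹ * fderiv ℝ φ x (EuclideanSpace.single i 1)) := by
    rw [← integral_const_mul]
    congr 1; funext x; field_simp
  have j2 : ∫ x, l * g (l • x) * φ x = l * ∫ x, g (l • x) * φ x := by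
    rw [← integral_const_mul]
    congr 1; funext x; ring
  rw [j1, j2, i1, i2]
  simp only [smul_eq_mul]
  ring

theorem eLpNorm_scale {N : ℕ} (f : Euc N → ℝ) (r : ℝ≥0∞) {l : ℝ} (hl : 0 < l) (a b : ℝ) :
    eLpNorm (fun x => f (l • x)) r (volume.restrict (Shell N a b)) =
      ENNReal.ofReal (l ^ (-((N : ℝ) / r.toReal))) *
        eLpNorm f r (volume.restrict (Shell N (l * a) (l * b))) := by
  have hl0 := hl.ne'
  have he : MeasurableEmbedding (fun x : Euc N => l • x) :=
    (Homeomorph.smulOfNeZero l hl0).measurableEmbedding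
  have hpre : (fun x : Euc N => l • x) ⁻¹' (Shell N (l * a) (l * b)) = Shell N a b := by
    ext x
    simp [Shell, norm_smul, abs_of_pos hl, hl]
  have h1 := he.restrict_map volume (Shell N (l * a) (l * b))
  rw [hpre, Measure.map_addHaar_smul _ hl0] at h1
  have h2 := he.eLpNorm_map_measure (p := r) (μ := volume.restrict (Shell N a b)) (g := f)
  rw [← h1, Measure.restrict_smul] at h2
  have hpos : 0 < |(l ^ Module.finrank ℝ (Euc N))⁻¹| := by positivity
  rw [eLpNorm_smul_measure_of_ne_zero (by simpa using hpos)] at h2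
  change _ = eLpNorm (fun x => f (l • x)) r (volume.restrict (Shell N a b)) at h2
  rw [← h2, smul_eq_mul]
  congr 1
  rw [ENNReal.ofReal_rpow_of_pos hpos, abs_of_pos (by positivity), finrank_euclideanSpace,
    Fintype.card_fin, ← Real.rpow_natCast, ← Real.rpow_neg hl.le, ← Real.rpow_mul hl.le]
  congr 2
  simp [div_eq_mul_inv]

theorem rpow_le_two {l y s c : ℝ} (hl : 0 < l) (hc : 1 ≤ c) (h1 : l / c ≤ y) (h2 : y ≤ c * l) :
    y ^ s ≤ c ^ |s| * l ^ s := by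
  have hc0 : 0 < c := by linarith
  have hy : 0 < y := lt_of_lt_of_le (by positivity) h1
  rcases le_total 0 s with hs | hs
  · rw [abs_of_nonneg hs, ← Real.mul_rpow hc0.le hl.le]
    exact Real.rpow_le_rpow hy.le h2 hs
  · rw [abs_of_nonpos hs, Real.rpow_neg hc0.le, ← Real.inv_rpow hc0.le,
      ← Real.mul_rpow (by positivity) hl.le]
    exact Real.rpow_le_rpow_of_nonpos (by positivity) (by rwa [inv_mul_eq_div]) hs

theorem dyadic {N : ℕ} (hN : 1 < N) (a : ℝ) {p : ℝ} (hp : 1 ≤ p) {q : ℝ≥0∞} (hq : q ∈ Ijp N 1 p) :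
    ∃ C : ℝ≥0∞, C ≠ ⊤ ∧ ∀ (u : Euc N → ℝ) (g : Fin N → Euc N → ℝ),
      (∀ x, radialSymmetrization u x = 0) → (∀ i, IsWeakPartialDeriv i u (g i)) →
      ∀ l : ℝ, 0 < l →
      eLpNorm (fun x => ‖x‖ ^ ((a + N) / p - (N : ℝ) / q.toReal) * u x) q
          (volume.restrict (Shell N l (2 * l))) ≤
        C * eLpNorm (fun x => ‖x‖ ^ (1 + a / p) * gradNorm1 g x) (ENNReal.ofReal p)
          (volume.restrict (Shell N (l / 4) (8 * l))) := by
  obtain ⟨C, hC, hmain⟩ := unit_weak hN hp hq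
  set s := (a + N) / p - (N : ℝ) / q.toReal with hs
  set t := 1 + a / p with ht
  have hp0 : 0 < p := by linarith
  refine ⟨ENNReal.ofReal (2 ^ |s|) * C * ENNReal.ofReal (8 ^ |(-t)|),
    ENNReal.mul_ne_top (ENNReal.mul_ne_top ENNReal.ofReal_ne_top hC) ENNReal.ofReal_ne_top, ?_⟩
  intro u g hS hg l hl
  have hS' : ∀ x, radialSymmetrization (fun x => u (l • x)) x = 0 := by
    intro x
    have := hS (l • x)
    simp only [radialSymmetrization, norm_smul, Real.norm_of_nonneg hl.le] at this ⊢
    simpa only [smul_smul] using this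
  have h1 := hmain (fun x => u (l • x)) (fun i x => l * g i (l • x)) hS'
    (fun i => weak_scale (hg i) hl)
  have hgn : gradNorm1 (fun i x => l * g i (l • x)) = fun x => l * gradNorm1 g (l • x) := by
    funext x
    simp only [gradNorm1, mul_pow, ← Finset.mul_sum]
    rw [Real.sqrt_mul (by positivity), Real.sqrt_sq hl.le]
  rw [hgn, eLpNorm_scale u q hl, eLpNorm_scale (fun y => l * gradNorm1 g y) (ENNReal.ofReal p) hl,
    ENNReal.toReal_ofReal hp0.le] at h1
  rw [show l * (1 : ℝ) = l by ring, show l * (2 : ℝ) = 2 * l by ring,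
    show l * (1 / 4 : ℝ) = l / 4 by ring, show l * (8 : ℝ) = 8 * l by ring] at h1
  set E := eLpNorm (fun x => ‖x‖ ^ t * gradNorm1 g x) (ENNReal.ofReal p)
          (volume.restrict (Shell N (l / 4) (8 * l))) with hE
  have hw1 : eLpNorm (fun x => ‖x‖ ^ s * u x) q (volume.restrict (Shell N l (2 * l)))
      ≤ ENNReal.ofReal (2 ^ |s| * l ^ s) * eLpNorm u q (volume.restrict (Shell N l (2 * l))) := by
    refine eLpNorm_le_mul_eLpNorm_of_ae_le_mul ?_ _
    filter_upwards [ae_restrict_mem (Shell_meas N l (2 * l))] with x hx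
    rw [norm_mul, Real.norm_of_nonneg (by positivity)]
    gcongr
    exact rpow_le_two hl (by norm_num) (by linarith [hx.1]) hx.2.le
  have hw2 : eLpNorm (fun y => l * gradNorm1 g y) (ENNReal.ofReal p)
        (volume.restrict (Shell N (l / 4) (8 * l)))
      ≤ ENNReal.ofReal (8 ^ |(-t)| * l ^ (-t) * l) * E := by
    refine eLpNorm_le_mul_eLpNorm_of_ae_le_mul ?_ _
    filter_upwards [ae_restrict_mem (Shell_meas N (l / 4) (8 * l))] with x hx
    have hx0 : 0 < ‖x‖ := lt_of_lt_of_le (by positivity) hx.1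
    have := rpow_le_two (s := -t) hl (c := 8) (y := ‖x‖) (by norm_num) (by linarith [hx.1]) hx.2.le
    rw [norm_mul, norm_mul, Real.norm_of_nonneg hl.le,
      Real.norm_of_nonneg (Real.rpow_nonneg hx0.le t)]
    calc l * ‖gradNorm1 g x‖ = ‖x‖ ^ (-t) * l * (‖x‖ ^ t * ‖gradNorm1 g x‖) := by
          rw [Real.rpow_neg hx0.le]; field_simp
      _ ≤ _ := by gcongr
  have hunscale : eLpNorm u q (volume.restrict (Shell N l (2 * l))) ≤
      ENNReal.ofReal (l ^ ((N : ℝ) / q.toReal)) * (C * (ENNReal.ofReal (l ^ (-((N : ℝ) / p))) *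
        (ENNReal.ofReal (8 ^ |(-t)| * l ^ (-t) * l) * E))) := by
    calc _ = ENNReal.ofReal (l ^ ((N : ℝ) / q.toReal)) * (ENNReal.ofReal (l ^ (-((N : ℝ) / q.toReal)))
          * eLpNorm u q (volume.restrict (Shell N l (2 * l)))) := by
          rw [← mul_assoc, ← ENNReal.ofReal_mul (by positivity), ← Real.rpow_add hl]
          simp
      _ ≤ _ := by
          refine mul_le_mul_right (h1.trans ?_) _
          gcongr
  calc _ ≤ _ := hw1
    _ ≤ ENNReal.ofReal (2 ^ |s| * l ^ s) * (ENNReal.ofReal (l ^ ((N : ℝ) / q.toReal)) *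
        (C * (ENNReal.ofReal (l ^ (-((N : ℝ) / p))) *
        (ENNReal.ofReal (8 ^ |(-t)| * l ^ (-t) * l) * E)))) := by gcongr
    _ = C * E * (ENNReal.ofReal (2 ^ |s| * l ^ s) * ENNReal.ofReal (l ^ ((N : ℝ) / q.toReal)) *
        ENNReal.ofReal (l ^ (-((N : ℝ) / p))) * ENNReal.ofReal (8 ^ |(-t)| * l ^ (-t) * l)) := by ring
    _ = C * E * (ENNReal.ofReal (2 ^ |s|) * ENNReal.ofReal (8 ^ |(-t)|)) := by
        congr 1
        rw [← ENNReal.ofReal_mul (by positivity), ← ENNReal.ofReal_mul (by positivity),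
          ← ENNReal.ofReal_mul (by positivity), ← ENNReal.ofReal_mul (by positivity)]
        congr 1
        have : l ^ s * l ^ ((N : ℝ) / q.toReal) * l ^ (-((N : ℝ) / p)) * l ^ (-t) * l = 1 := by
          rw [← Real.rpow_add hl, ← Real.rpow_add hl, ← Real.rpow_add hl]
          nth_rewrite 2 [← Real.rpow_one l]
          rw [← Real.rpow_add hl]
          have : s + (N : ℝ) / q.toReal + -((N : ℝ) / p) + -t + 1 = 0 := by
            rw [hs, ht]; ring
          rw [this, Real.rpow_zero]
        calc _ = (2 ^ |s| * 8 ^ |(-t)|) * (l ^ s * l ^ ((N : ℝ) / q.toReal) * l ^ (-((N : ℝ) / p))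
            * l ^ (-t) * l) := by ring
          _ = _ := by rw [this, mul_one]
    _ = _ := by ring

theorem tsum_rpow_le {ι : Type*} (b : ι → ℝ≥0∞) {r : ℝ} (hr : 1 ≤ r) :
    ∑' k, b k ^ r ≤ (∑' k, b k) ^ r := by
  have e : ∀ y : ℝ≥0∞, y ^ r = y * y ^ (r - 1) := by
    intro y
    have : y ^ r = y ^ (1 + (r - 1)) := by congr 1; ring
    rw [this, ENNReal.rpow_add_of_nonneg _ _ (by norm_num) (by linarith), ENNReal.rpow_one]
  calc ∑' k, b k ^ r ≤ ∑' k, b k * (∑' k, b k) ^ (r - 1) := by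
        refine ENNReal.tsum_le_tsum fun k => ?_
        rw [e]
        gcongr
        exact ENNReal.le_tsum k
    _ = _ := by rw [ENNReal.tsum_mul_right, ← e]

/-- Dyadic shells. -/
def DS (N : ℕ) (k : ℤ) : Set (Euc N) := Shell N ((2 : ℝ) ^ k) (2 * (2 : ℝ) ^ k)

theorem DS_meas (N : ℕ) (k : ℤ) : MeasurableSet (DS N k) := Shell_meas _ _ _

theorem DS_disj (N : ℕ) : Pairwise (Function.onFun Disjoint (DS N)) := by
  have key : ∀ j k : ℤ, j < k → Disjoint (DS N j) (DS N k) := by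
    intro j k hjk
    rw [Set.disjoint_left]
    intro x h1 h2
    have h3 : (2 : ℝ) ^ (j + 1) ≤ (2 : ℝ) ^ k := zpow_le_zpow_right₀ (by norm_num) (by omega)
    rw [zpow_add_one₀ (by norm_num)] at h3
    linarith [h1.2, h2.1]
  intro j k hjk
  rcases lt_or_gt_of_ne hjk with h | h
  · exact key _ _ h
  · exact (key _ _ h).symm

theorem DS_ex {N : ℕ} {x : Euc N} (hx : x ≠ 0) : ∃ k, x ∈ DS N k := by
  obtain ⟨k, hk⟩ := exists_mem_Ico_zpow (norm_pos_iff.2 hx) (one_lt_two)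
  refine ⟨k, hk.1, ?_⟩
  have := hk.2
  rw [zpow_add_one₀ (by norm_num)] at this
  linarith

theorem DS_union (N : ℕ) : ⋃ k, DS N k = {0}ᶜ := by
  ext x
  simp only [Set.mem_iUnion, Set.mem_compl_iff, Set.mem_singleton_iff]
  constructor
  · rintro ⟨k, hk⟩ rfl
    have h1 := hk.1
    rw [norm_zero] at h1
    have : (0 : ℝ) < 2 ^ k := by positivity
    linarith
  · exact DS_ex

theorem lintegral_DS {N : ℕ} (hN : 0 < N) (f : Euc N → ℝ≥0∞) :
    ∫⁻ x, f x = ∑' k, ∫⁻ x in DS N k, f x := by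
  have : Nonempty (Fin N) := ⟨⟨0, hN⟩⟩
  rw [← lintegral_iUnion (DS_meas N) (DS_disj N), DS_union, restrict_compl_singleton]

theorem big_sub (N : ℕ) (k : ℤ) : Shell N ((2 : ℝ) ^ k / 4) (8 * (2 : ℝ) ^ k) ⊆
    DS N (k + -2) ∪ DS N (k + -1) ∪ DS N (k + 0) ∪ DS N (k + 1) ∪ DS N (k + 2) := by
  intro x hx
  have h0 : (0 : ℝ) < 2 ^ k := by positivity
  have hx0 : x ≠ 0 := by
    rintro rfl
    have := hx.1
    rw [norm_zero] at this
    linarith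
  obtain ⟨j, hj⟩ := DS_ex hx0
  have h1 : k + -2 ≤ j := by
    by_contra hcon
    have h3 : (2 : ℝ) ^ (j + 1) ≤ (2 : ℝ) ^ (k + -2) := zpow_le_zpow_right₀ (by norm_num) (by omega)
    rw [zpow_add_one₀ (by norm_num), zpow_add₀ (by norm_num)] at h3
    norm_num at h3
    linarith [hj.2, hx.1]
  have h2 : j ≤ k + 2 := by
    by_contra hcon
    have h3 : (2 : ℝ) ^ (k + 3) ≤ (2 : ℝ) ^ j := zpow_le_zpow_right₀ (by norm_num) (by omega)
    rw [zpow_add₀ (by norm_num)] at h3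
    norm_num at h3
    linarith [hj.1, hx.2]
  have : j = k + -2 ∨ j = k + -1 ∨ j = k + 0 ∨ j = k + 1 ∨ j = k + 2 := by omega
  rcases this with rfl | rfl | rfl | rfl | rfl <;> simp [hj]
  all_goals simp at hj; simp [hj]

theorem sum_big {N : ℕ} (hN : 0 < N) (f : Euc N → ℝ≥0∞) :
    ∑' k : ℤ, ∫⁻ x in Shell N ((2 : ℝ) ^ k / 4) (8 * (2 : ℝ) ^ k), f x ≤ 5 * ∫⁻ x, f x := by
  have hsh : ∀ j : ℤ, ∑' k : ℤ, ∫⁻ x in DS N (k + j), f x = ∫⁻ x, f x := by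
    intro j
    rw [lintegral_DS hN f]
    exact (Equiv.addRight j).tsum_eq (fun k => ∫⁻ x in DS N k, f x)
  calc _ ≤ ∑' k : ℤ, ((∫⁻ x in DS N (k + -2), f x) + (∫⁻ x in DS N (k + -1), f x)
        + (∫⁻ x in DS N (k + 0), f x) + (∫⁻ x in DS N (k + 1), f x)
        + (∫⁻ x in DS N (k + 2), f x)) := by
        refine ENNReal.tsum_le_tsum fun k => ?_
        refine (lintegral_mono_set (big_sub N k)).trans ?_
        refine (lintegral_union_le _ _ _).trans (add_le_add ?_ le_rfl)
        refine (lintegral_union_le _ _ _).trans (add_le_add ?_ le_rfl)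
        refine (lintegral_union_le _ _ _).trans (add_le_add ?_ le_rfl)
        exact lintegral_union_le _ _ _
    _ = 5 * ∫⁻ x, f x := by
        rw [ENNReal.tsum_add, ENNReal.tsum_add, ENNReal.tsum_add, ENNReal.tsum_add]
        simp only [hsh]
        ring

theorem global_est {N : ℕ} (hN : 1 < N) (a : ℝ) {p : ℝ} (hp : 1 ≤ p) {q : ℝ≥0∞}
    (hq : q ∈ Ijp N 1 p) :
    ∃ C : ℝ≥0∞, C ≠ ⊤ ∧ ∀ (u : Euc N → ℝ) (g : Fin N → Euc N → ℝ),
      (∀ x, radialSymmetrization u x = 0) → (∀ i, IsWeakPartialDeriv i u (g i)) →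
      eLpNorm (fun x => ‖x‖ ^ ((a + N) / p - (N : ℝ) / q.toReal) * u x) q volume ≤
        C * eLpNorm (fun x => ‖x‖ ^ (1 + a / p) * gradNorm1 g x) (ENNReal.ofReal p) volume := by
  obtain ⟨C, hC, hmain⟩ := dyadic hN a hp hq
  have hN0 : 0 < N := by omega
  have : Nonempty (Fin N) := ⟨⟨0, hN0⟩⟩
  have hp0 : 0 < p := by linarith
  refine ⟨C * 5 ^ (1 / p), ENNReal.mul_ne_top hC
    (ENNReal.rpow_ne_top_of_nonneg (by positivity) (by simp)), ?_⟩
  intro u g hS hg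
  set s := (a + N) / p - (N : ℝ) / q.toReal
  set f : Euc N → ℝ := fun x => ‖x‖ ^ s * u x
  set F : Euc N → ℝ := fun x => ‖x‖ ^ (1 + a / p) * gradNorm1 g x
  have hk : ∀ k : ℤ, eLpNorm f q (volume.restrict (DS N k)) ≤
      C * eLpNorm F (ENNReal.ofReal p)
        (volume.restrict (Shell N ((2 : ℝ) ^ k / 4) (8 * (2 : ℝ) ^ k))) :=
    fun k => hmain u g hS hg ((2 : ℝ) ^ k) (by positivity)
  rcases Ijp_cases hN hp hq with ⟨rfl, -⟩ | ⟨q', rfl, h1, -⟩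
  · have hone : (1 : ℝ≥0∞) ≤ 5 ^ (1 / p) := ENNReal.one_le_rpow (by norm_num) (by positivity)
    rw [eLpNorm_exponent_top]
    refine eLpNormEssSup_le_of_ae_enorm_bound ?_
    have hae : ∀ k : ℤ, ∀ᵐ x : Euc N, x ∈ DS N k →
        ‖f x‖ₑ ≤ C * 5 ^ (1 / p) * eLpNorm F (ENNReal.ofReal p) volume := by
      intro k
      rw [← ae_restrict_iff' (DS_meas N k)]
      have h2 := hk k
      rw [eLpNorm_exponent_top] at h2
      filter_upwards [enorm_ae_le_eLpNormEssSup f (volume.restrict (DS N k))] with x hx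
      refine hx.trans (h2.trans ?_)
      have h3 : eLpNorm F (ENNReal.ofReal p)
        (volume.restrict (Shell N ((2 : ℝ) ^ k / 4) (8 * (2 : ℝ) ^ k)))
        ≤ eLpNorm F (ENNReal.ofReal p) volume := eLpNorm_mono_measure _ Measure.restrict_le_self
      calc _ ≤ C * 1 * eLpNorm F (ENNReal.ofReal p) volume := by rw [mul_one]; gcongr
        _ ≤ _ := by gcongr
    filter_upwards [ae_all_iff.2 hae, Measure.ae_ne volume (0 : Euc N)] with x hx hx0
    obtain ⟨k, hkx⟩ := DS_ex hx0
    exact hx k hkx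
  · have hq1 : 1 ≤ q' := by linarith
    have hq0 : 0 < q' := by linarith
    have hr : 1 ≤ q' / p := by rw [le_div_iff₀ hp0]; linarith
    rw [eLpNorm_ofReal_eq _ _ hq1, eLpNorm_ofReal_eq _ _ hp, lintegral_DS hN0]
    have hk2 : ∀ k : ℤ, ∫⁻ x in DS N k, ‖f x‖ₑ ^ q' ≤ C ^ q' *
        (∫⁻ x in Shell N ((2 : ℝ) ^ k / 4) (8 * (2 : ℝ) ^ k), ‖F x‖ₑ ^ p) ^ (q' / p) := by
      intro k
      have h2 := ENNReal.rpow_le_rpow (hk k) hq0.le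
      rw [eLpNorm_ofReal_eq _ _ hq1, eLpNorm_ofReal_eq _ _ hp, ← ENNReal.rpow_mul,
        one_div_mul_cancel hq0.ne', ENNReal.rpow_one, ENNReal.mul_rpow_of_nonneg _ _ hq0.le,
        ← ENNReal.rpow_mul] at h2
      rwa [show q' / p = 1 / p * q' by ring]
    have htot : ∑' k, ∫⁻ x in DS N k, ‖f x‖ₑ ^ q' ≤ C ^ q' * (5 * ∫⁻ x, ‖F x‖ₑ ^ p) ^ (q' / p) := by
      refine (ENNReal.tsum_le_tsum hk2).trans ?_
      rw [ENNReal.tsum_mul_left]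
      gcongr
      refine (tsum_rpow_le _ hr).trans ?_
      gcongr
      exact sum_big hN0 _
    refine (ENNReal.rpow_le_rpow htot (by positivity : 0 ≤ 1 / q')).trans (le_of_eq ?_)
    rw [ENNReal.mul_rpow_of_nonneg _ _ (by positivity), ← ENNReal.rpow_mul, ← ENNReal.rpow_mul,
      mul_one_div_cancel hq0.ne', ENNReal.rpow_one,
      show q' / p * (1 / q') = 1 / p by field_simp, ENNReal.mul_rpow_of_nonneg _ _ (by positivity)]
    ring

theorem F_fin {N : ℕ} (a p : ℝ) (hp : 1 ≤ p) (g : Fin N → Euc N → ℝ)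
    (h : ∀ i, MemLp (fun x : Euc N => ‖x‖ ^ (1 + a / p) * g i x) (ENNReal.ofReal p) volume) :
    eLpNorm (fun x : Euc N => ‖x‖ ^ (1 + a / p) * gradNorm1 g x) (ENNReal.ofReal p) volume < ⊤ := by
  have h1 : MemLp (fun x => ∑ i, ‖‖x‖ ^ (1 + a / p) * g i x‖) (ENNReal.ofReal p) volume :=
    memLp_finsetSum _ fun i _ => (h i).norm
  refine lt_of_le_of_lt (eLpNorm_mono fun x => ?_) h1.2
  have hnn : 0 ≤ ‖x‖ ^ (1 + a / p) := by positivity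
  rw [norm_mul, Real.norm_of_nonneg (Finset.sum_nonneg fun i _ => norm_nonneg _),
    Real.norm_of_nonneg hnn]
  simp only [norm_mul, Real.norm_of_nonneg hnn, ← Finset.mul_sum]
  gcongr
  unfold gradNorm1
  rw [Real.norm_of_nonneg (Real.sqrt_nonneg _)]
  refine Real.sqrt_le_iff.2 ⟨Finset.sum_nonneg fun i _ => norm_nonneg _, ?_⟩
  have := Finset.sum_sq_le_sq_sum_of_nonneg (s := Finset.univ) (f := fun i => ‖g i x‖)
    (fun i _ => norm_nonneg _)
  simpa using this

theorem limit_part {N : ℕ} (hN : 1 < N) (a p : ℝ) (hp : 1 ≤ p) (hNp : (N : ℝ) < p)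
    (u : Euc N → ℝ) (g : Fin N → Euc N → ℝ)
    (hS : ∀ x, radialSymmetrization u x = 0)
    (hg : ∀ i, IsWeakPartialDeriv i u (g i))
    (hF : eLpNorm (fun x : Euc N => ‖x‖ ^ (1 + a / p) * gradNorm1 g x)
      (ENNReal.ofReal p) volume < ⊤) :
    ∃ v : Euc N → ℝ, v =ᵐ[volume] u ∧
      Tendsto (fun x : Euc N => ‖x‖ ^ ((a + (N : ℝ)) / p) * v x) (cocompact (Euc N)) (nhds 0) := by
  have hN0 : 0 < N := by omega
  have hp0 : 0 < p := by linarith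
  have hq : (⊤ : ℝ≥0∞) ∈ Ijp N 1 p := by
    unfold Ijp
    simp only [Nat.cast_one, div_one, one_mul]
    rw [if_neg (fun h => by linarith [h.1]), if_neg (by linarith)]
    simp
  obtain ⟨C, hC, hmain⟩ := dyadic hN a hp hq
  have hs0 : (a + (N : ℝ)) / p - (N : ℝ) / (⊤ : ℝ≥0∞).toReal = (a + N) / p := by simp
  rw [hs0] at hmain
  set f : Euc N → ℝ := fun x => ‖x‖ ^ ((a + (N : ℝ)) / p) * u x with hf
  set F : Euc N → ℝ := fun x => ‖x‖ ^ (1 + a / p) * gradNorm1 g x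
  set b : ℤ → ℝ≥0∞ := fun k => ∫⁻ x in Shell N ((2 : ℝ) ^ k / 4) (8 * (2 : ℝ) ^ k), ‖F x‖ₑ ^ p
  have hbsum : ∑' k, b k ≠ ⊤ := by
    refine ne_top_of_le_ne_top ?_ (sum_big hN0 _)
    refine ENNReal.mul_ne_top (by simp) ?_
    rw [eLpNorm_ofReal_eq _ _ hp] at hF
    intro h
    rw [h, ENNReal.top_rpow_of_pos (by positivity)] at hF
    exact lt_irrefl _ hF
  have hb0 := ENNReal.tendsto_cofinite_zero_of_tsum_ne_top hbsum
  have hc0 : Tendsto (fun k => C * b k ^ (1 / p)) cofinite (𝓝 0) := by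
    have h1 : Tendsto (fun k => b k ^ (1 / p)) cofinite (𝓝 0) := by
      have := (ENNReal.continuous_rpow_const (y := 1 / p)).tendsto 0 |>.comp hb0
      rwa [ENNReal.zero_rpow_of_pos (by positivity)] at this
    have := ENNReal.Tendsto.const_mul (a := C) h1 (Or.inr hC)
    rwa [mul_zero] at this
  have hae : ∀ᵐ x : Euc N, ∀ k : ℤ, x ∈ DS N k → ‖f x‖ₑ ≤ C * b k ^ (1 / p) := by
    rw [ae_all_iff]
    intro k
    rw [← ae_restrict_iff' (DS_meas N k)]
    have h2 := hmain u g hS hg ((2 : ℝ) ^ k) (by positivity)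
    rw [eLpNorm_exponent_top, eLpNorm_ofReal_eq _ _ hp] at h2
    filter_upwards [enorm_ae_le_eLpNormEssSup f (volume.restrict (DS N k))] with x hx
    exact hx.trans h2
  classical
  refine ⟨fun x => if (∀ k : ℤ, x ∈ DS N k → ‖f x‖ₑ ≤ C * b k ^ (1 / p)) then u x else 0, ?_, ?_⟩
  · filter_upwards [hae] with x hx
    rw [if_pos hx]
  rw [tendsto_zero_iff_norm_tendsto_zero, Metric.tendsto_nhds]
  intro ε hε
  have hev : ∀ᶠ k : ℤ in cofinite, C * b k ^ (1 / p) < ENNReal.ofReal ε :=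
    hc0.eventually (gt_mem_nhds (by simpa using hε))
  obtain ⟨K, hK⟩ : ∃ K : ℤ, ∀ k, K ≤ k → C * b k ^ (1 / p) < ENNReal.ofReal ε := by
    have : ∀ᶠ k : ℤ in atTop, C * b k ^ (1 / p) < ENNReal.ofReal ε :=
      hev.filter_mono atTop_le_cofinite
    exact eventually_atTop.1 this
  have hlarge : ∀ᶠ x : Euc N in cocompact (Euc N), (2 : ℝ) ^ K ≤ ‖x‖ :=
    (tendsto_norm_cocompact_atTop (E := Euc N)).eventually_ge_atTop _
  filter_upwards [hlarge] with x hx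
  rw [dist_zero_right, norm_norm]
  split_ifs with hgood
  · have h0 : (0 : ℝ) < 2 ^ K := by positivity
    obtain ⟨k, hk⟩ := DS_ex (x := x) (norm_pos_iff.1 (by linarith))
    have hKk : K ≤ k := by
      by_contra hcon
      have h3 : (2 : ℝ) ^ (k + 1) ≤ (2 : ℝ) ^ K := zpow_le_zpow_right₀ (by norm_num) (by omega)
      rw [zpow_add_one₀ (by norm_num)] at h3
      linarith [hk.2]
    have h4 := lt_of_le_of_lt (hgood k hk) (hK k hKk)
    rw [← ofReal_norm, ENNReal.ofReal_lt_ofReal_iff hε] at h4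
    exact h4
  · simpa using hε

/-- Lemma 7. Suppose `N > 1`. If `u ∈ L^1_loc` with `u_S = 0`,
`|x|^{a/p} u ∈ L^p` and `|x|^{1+a/p} ∇u ∈ (L^p)^N`, then for every `q ∈ I_{1,p}`,
`‖ |x|^{(a+N)/p - N/q} u ‖_q ≤ C ‖ |x|^{1+a/p} |∇u| ‖_p` with `C = C(a,p,q)` independent
of `u`; and if `p > N` then (a representative of) `u` satisfies
`|x|^{(a+N)/p} u(x) → 0` as `|x| → ∞`. -/
theorem stmt_10 {N : ℕ} (hN : 1 < N) (a p : ℝ) (hp : 1 ≤ p) :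
    (∀ q ∈ Ijp N 1 p, ∃ C : ℝ, 0 < C ∧
      ∀ (u : Euc N → ℝ) (g : Fin N → Euc N → ℝ),
        (∀ x, radialSymmetrization u x = 0) →
        MemLp (fun x : Euc N => ‖x‖ ^ (a / p) * u x) (ENNReal.ofReal p) volume →
        (∀ i, IsWeakPartialDeriv i u (g i)) →
        (∀ i, MemLp (fun x : Euc N => ‖x‖ ^ (1 + a / p) * g i x) (ENNReal.ofReal p) volume) →
        MemLp (fun x : Euc N => ‖x‖ ^ ((a + N) / p - (N : ℝ) / q.toReal) * u x) q volume ∧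
          (eLpNorm (fun x : Euc N => ‖x‖ ^ ((a + N) / p - (N : ℝ) / q.toReal) * u x)
              q volume).toReal
            ≤ C * (eLpNorm (fun x : Euc N => ‖x‖ ^ (1 + a / p) * gradNorm1 g x)
                (ENNReal.ofReal p) volume).toReal) ∧
    ((N : ℝ) < p →
      ∀ (u : Euc N → ℝ) (g : Fin N → Euc N → ℝ),
        (∀ x, radialSymmetrization u x = 0) →
        MemLp (fun x : Euc N => ‖x‖ ^ (a / p) * u x) (ENNReal.ofReal p) volume →
        (∀ i, IsWeakPartialDeriv i u (g i)) →
        (∀ i, MemLp (fun x : Euc N => ‖x‖ ^ (1 + a / p) * g i x) (ENNReal.ofReal p) volume) →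
        ∃ v : Euc N → ℝ, v =ᵐ[volume] u ∧
          Tendsto (fun x : Euc N => ‖x‖ ^ ((a + (N : ℝ)) / p) * v x)
            (cocompact (Euc N)) (nhds 0)) := by
  refine ⟨?_, ?_⟩
  · intro q hq
    obtain ⟨C, hC, h⟩ := global_est hN a hp hq
    refine ⟨C.toReal + 1, by positivity, ?_⟩
    intro u g hS _ hg hgm
    have hF := F_fin a p hp g hgm
    have hle := h u g hS hg
    have hfin := ENNReal.mul_ne_top hC hF.ne
    have hu : AEStronglyMeasurable u volume := (hg ⟨0, by omega⟩).1.aestronglyMeasurable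
    refine ⟨⟨(measurable_norm.pow_const _).aestronglyMeasurable.mul hu,
      lt_of_le_of_lt hle hfin.lt_top⟩, ?_⟩
    have h2 := ENNReal.toReal_mono hfin hle
    rw [ENNReal.toReal_mul] at h2
    refine h2.trans (mul_le_mul_of_nonneg_right (by linarith) ENNReal.toReal_nonneg)
  · intro hNp u g hS _ hg hgm
    exact limit_part hN a p hp hNp u g hS hg (F_fin a p hp g hgm)

end
end
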